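/- arXiv:2312.15333 — 4 statements merged into one kernel-verified Lean document; each statement's English description precedes it below -/
import Mathlib

section
/- There exists d ≥ 40 for which the following holds. Let ε ∈ (0, 1/2), and let G be a graph with no copy of the complement of P5 and with |G| ≥ ε^{-10d²}. Then there is an (ε^{-1}, ε^{10d²}·|G|)-blockade (B_1, …, B_ℓ) in G such that for all distinct i, j ∈ {1, …, ℓ}, the pair (B_i, B_j) is either complete or weakly ε^d-sparse in G. -/
open Finset
open scoped Classical

/-- A copy of `H` in `G`: an injective map preserving adjacency and non-adjacency. -/
def IsCopy {W V : Type*} (H : SimpleGraph W) (G : SimpleGraph V) (f : W → V) : Prop :=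
  Function.Injective f ∧ ∀ u v : W, H.Adj u v ↔ G.Adj (f u) (f v)

/-- `G` is `H`-free: there is no copy of `H` in `G`. -/
def Free {W V : Type*} (H : SimpleGraph W) (G : SimpleGraph V) : Prop :=
  ¬ ∃ f : W → V, IsCopy H G f

/-- The path on five vertices. -/
def P5 : SimpleGraph (Fin 5) := SimpleGraph.pathGraph 5

/-- The neighbours of `v` inside the finite set `A`. -/
noncomputable def nbrsIn {V : Type*} (G : SimpleGraph V) (v : V) (A : Finset V) : Finset V :=
  A.filter (fun u => G.Adj v u)

/-- `G` is `x`-sparse: every vertex has degree at most `x * |G|`. -/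
def Sparse {V : Type*} [Fintype V] (G : SimpleGraph V) (x : ℝ) : Prop :=
  ∀ v : V, ((nbrsIn G v Finset.univ).card : ℝ) ≤ x * (Fintype.card V : ℝ)

/-- `G` is `x`-restricted: `G` or its complement is `x`-sparse. -/
def Restricted {V : Type*} [Fintype V] (G : SimpleGraph V) (x : ℝ) : Prop :=
  Sparse G x ∨ Sparse Gᶜ x

/-- The induced subgraph `G[S]` is `x`-sparse. -/
def SparseOn {V : Type*} (G : SimpleGraph V) (S : Finset V) (x : ℝ) : Prop :=
  ∀ v ∈ S, ((nbrsIn G v S).card : ℝ) ≤ x * (S.card : ℝ)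

/-- The induced subgraph `G[S]` is `x`-restricted: it or its complement is `x`-sparse. -/
def RestrictedOn {V : Type*} (G : SimpleGraph V) (S : Finset V) (x : ℝ) : Prop :=
  SparseOn G S x ∨ SparseOn Gᶜ S x

/-- `(A, B)` is complete in `G`. -/
def CompletePair {V : Type*} (G : SimpleGraph V) (A B : Finset V) : Prop :=
  ∀ a ∈ A, ∀ b ∈ B, G.Adj a b

/-- `(A, B)` is anticomplete in `G`. -/
def AnticompletePair {V : Type*} (G : SimpleGraph V) (A B : Finset V) : Prop :=
  ∀ a ∈ A, ∀ b ∈ B, ¬ G.Adj a b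

/-- `B` is `x`-sparse to `A` in `G`: every vertex of `B` has at most `x * |A|` neighbours in `A`. -/
def SparseTo {V : Type*} (G : SimpleGraph V) (x : ℝ) (A B : Finset V) : Prop :=
  ∀ v ∈ B, ((nbrsIn G v A).card : ℝ) ≤ x * (A.card : ℝ)

/-- The number of edges of `G` between `A` and `B`. -/
noncomputable def edgesBetween {V : Type*} (G : SimpleGraph V) (A B : Finset V) : ℕ :=
  ((A ×ˢ B).filter (fun p => G.Adj p.1 p.2)).card

/-- `(A, B)` is weakly `x`-sparse in `G`. -/
def WeaklySparse {V : Type*} (G : SimpleGraph V) (x : ℝ) (A B : Finset V) : Prop :=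
  (edgesBetween G A B : ℝ) ≤ x * (A.card : ℝ) * (B.card : ℝ)

/-- A blockade: a sequence of pairwise disjoint vertex subsets. -/
def IsBlockade {V : Type*} {n : ℕ} (B : Fin n → Finset V) : Prop :=
  ∀ i j : Fin n, i ≠ j → Disjoint (B i) (B j)

/-- A pure blockade: every pair of distinct blocks is complete or anticomplete. -/
def PureBlockade {V : Type*} (G : SimpleGraph V) {n : ℕ} (B : Fin n → Finset V) : Prop :=
  ∀ i j : Fin n, i ≠ j → CompletePair G (B i) (B j) ∨ AnticompletePair G (B i) (B j)

/-- A complete blockade. -/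
def CompleteBlockade {V : Type*} (G : SimpleGraph V) {n : ℕ} (B : Fin n → Finset V) : Prop :=
  ∀ i j : Fin n, i ≠ j → CompletePair G (B i) (B j)

/-- An anticomplete blockade. -/
def AnticompleteBlockade {V : Type*} (G : SimpleGraph V) {n : ℕ} (B : Fin n → Finset V) : Prop :=
  ∀ i j : Fin n, i ≠ j → AnticompletePair G (B i) (B j)

/-- An `x`-sparse blockade: `B j` is `x`-sparse to `B i` whenever `i < j`. -/
def SparseBlockade {V : Type*} (G : SimpleGraph V) (x : ℝ) {n : ℕ} (B : Fin n → Finset V) : Prop :=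
  ∀ i j : Fin n, i < j → SparseTo G x (B i) (B j)

/-- A comb: a blockade `Bl` together with distinct apexes `a i`, outside all blocks, such that
`a i` is adjacent to all of `Bl i` and nonadjacent to all of `Bl j` for `j ≠ i`. -/
def IsComb {V : Type*} (G : SimpleGraph V) {k : ℕ} (a : Fin k → V) (Bl : Fin k → Finset V) :
    Prop :=
  IsBlockade Bl ∧ Function.Injective a ∧ (∀ i j : Fin k, a i ∉ Bl j) ∧
  (∀ i : Fin k, ∀ v ∈ Bl i, G.Adj (a i) v) ∧
  (∀ i j : Fin k, i ≠ j → ∀ v ∈ Bl j, ¬ G.Adj (a i) v)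

lemma not_house_free_of_path {V : Type} {G : SimpleGraph V} (hG : Free P5ᶜ G) {a b c d e : V}
    (ab : a ≠ b) (bc : b ≠ c) (cd : c ≠ d) (de : d ≠ e)
    (nab : ¬ G.Adj a b) (nbc : ¬ G.Adj b c) (ncd : ¬ G.Adj c d) (nde : ¬ G.Adj d e)
    (hac : G.Adj a c) (had : G.Adj a d) (hae : G.Adj a e)
    (hbd : G.Adj b d) (hbe : G.Adj b e) (hce : G.Adj c e) : False := by
  have nba : ¬ G.Adj b a := fun h => nab h.symm
  have ncb : ¬ G.Adj c b := fun h => nbc h.symm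
  have ndc : ¬ G.Adj d c := fun h => ncd h.symm
  have ned : ¬ G.Adj e d := fun h => nde h.symm
  apply hG
  refine ⟨![a, b, c, d, e], ?_, ?_⟩
  · intro i j hij
    fin_cases i <;> fin_cases j <;> first
      | rfl
      | (exfalso; simp at hij; simp_all)
  · intro i j
    fin_cases i <;> fin_cases j <;>
      simp [P5, SimpleGraph.pathGraph_adj, hac, had, hae, hbd, hbe, hce, hac.symm, had.symm,
        hae.symm, hbd.symm, hbe.symm, hce.symm, nab, nbc, ncd, nde, nba, ncb, ndc, ned]

/-- `D` is connected in the complement of `G`. -/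
def Anticonn {V : Type} (G : SimpleGraph V) (D : Finset V) : Prop :=
  ∀ C ⊆ D, C.Nonempty → C ≠ D → ∃ a ∈ C, ∃ b ∈ D \ C, ¬ G.Adj a b

/-- Either the pair is complete, or one side has few neighbours of each vertex of the other. -/
def BlockRel {V : Type} (G : SimpleGraph V) (θ : ℝ) (P Q : Finset V) : Prop :=
  CompletePair G P Q ∨ (∀ p ∈ P, ((nbrsIn G p Q).card : ℝ) ≤ θ) ∨
    (∀ q ∈ Q, ((nbrsIn G q P).card : ℝ) ≤ θ)

/-- `S` contains at least `y` disjoint blocks of size at least `w`, pairwise related. -/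
def HasBl {V : Type} (G : SimpleGraph V) (θ : ℝ) (S : Finset V) (y w : ℝ) : Prop :=
  ∃ (ι : Type) (_ : Fintype ι) (B : ι → Finset V), y ≤ (Fintype.card ι : ℝ) ∧
    (∀ i, B i ⊆ S) ∧ (∀ i, w ≤ ((B i).card : ℝ)) ∧
    (∀ i j, i ≠ j → Disjoint (B i) (B j) ∧ BlockRel G θ (B i) (B j))

lemma CompletePair.symm' {V : Type} {G : SimpleGraph V} {P Q : Finset V} (h : CompletePair G P Q) :
    CompletePair G Q P := fun q hq p hp => (h p hp q hq).symm

lemma nbrsIn_mono {V : Type} {G : SimpleGraph V} {v : V} {P Q : Finset V} (h : P ⊆ Q) :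
    nbrsIn G v P ⊆ nbrsIn G v Q := filter_subset_filter _ h

lemma card_nbrsIn_mono {V : Type} {G : SimpleGraph V} {v : V} {P Q : Finset V} (h : P ⊆ Q) :
    ((nbrsIn G v P).card : ℝ) ≤ ((nbrsIn G v Q).card : ℝ) := by
  exact_mod_cast card_le_card (nbrsIn_mono h)

lemma BlockRel.symm {V : Type} {G : SimpleGraph V} {θ : ℝ} {P Q : Finset V} (h : BlockRel G θ P Q) :
    BlockRel G θ Q P := by
  rcases h with h | h | h
  · exact Or.inl h.symm'
  · exact Or.inr (Or.inr h)
  · exact Or.inr (Or.inl h)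

lemma BlockRel.mono {V : Type} {G : SimpleGraph V} {θ : ℝ} {P Q P' Q' : Finset V} (h : BlockRel G θ P Q)
    (hP : P' ⊆ P) (hQ : Q' ⊆ Q) : BlockRel G θ P' Q' := by
  rcases h with h | h | h
  · exact Or.inl fun a ha b hb => h a (hP ha) b (hQ hb)
  · exact Or.inr (Or.inl fun p hp => (card_nbrsIn_mono hQ).trans (h p (hP hp)))
  · exact Or.inr (Or.inr fun p hp => (card_nbrsIn_mono hP).trans (h p (hQ hp)))

lemma BlockRel.mono_theta {V : Type} {G : SimpleGraph V} {θ θ' : ℝ} {P Q : Finset V} (h : BlockRel G θ P Q)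
    (hθ : θ ≤ θ') : BlockRel G θ' P Q := by
  rcases h with h | h | h
  · exact Or.inl h
  · exact Or.inr (Or.inl fun p hp => (h p hp).trans hθ)
  · exact Or.inr (Or.inr fun p hp => (h p hp).trans hθ)

lemma blockRel_of_anticomplete {V : Type} {G : SimpleGraph V} {P Q : Finset V} (h : AnticompletePair G P Q) :
    BlockRel G 0 P Q := by
  refine Or.inr (Or.inl fun p hp => ?_)
  have : nbrsIn G p Q = ∅ := by
    rw [nbrsIn, filter_eq_empty_iff]; exact fun q hq => h p hp q hq
  simp [this]

lemma HasBl.mono {V : Type} {G : SimpleGraph V} {θ θ' y y' w w' : ℝ} {S S' : Finset V}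
    (h : HasBl G θ S y w) (hθ : θ ≤ θ') (hS : S ⊆ S') (hy : y' ≤ y) (hw : w' ≤ w) :
    HasBl G θ' S' y' w' := by
  obtain ⟨ι, _, B, h1, h2, h3, h4⟩ := h
  exact ⟨ι, _, B, hy.trans h1, fun i => (h2 i).trans hS, fun i => hw.trans (h3 i),
    fun i j hij => ⟨(h4 i j hij).1, (h4 i j hij).2.mono_theta hθ⟩⟩

lemma hasBl_pair {V : Type} {G : SimpleGraph V} {θ w : ℝ} {S P Q : Finset V} (hP : P ⊆ S) (hQ : Q ⊆ S)
    (hd : Disjoint P Q) (hr : BlockRel G θ P Q) (wP : w ≤ (P.card : ℝ)) (wQ : w ≤ (Q.card : ℝ)) :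
    HasBl G θ S 2 w := by
  refine ⟨Bool, inferInstance, fun b => if b then P else Q, by simp, ?_, ?_, ?_⟩
  · intro i; cases i <;> simp [hP, hQ]
  · intro i; cases i <;> simp [wP, wQ]
  · intro i j hij
    cases i <;> cases j <;> simp at hij ⊢
    · exact ⟨hd.symm, hr.symm⟩
    · exact ⟨hd, hr⟩

/-- Either `A` has a large anticomponent, or it contains `k` large pairwise complete sets. -/
lemma anticomponent_or_complete {V : Type} (G : SimpleGraph V) {m : ℝ} (hm : 0 < m) (k : ℕ) (A : Finset V)
    (hA : 2 * k * m ≤ (A.card : ℝ)) :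
    (∃ D ⊆ A, m ≤ (D.card : ℝ) ∧ Anticonn G D ∧ CompletePair G D (A \ D)) ∨
    ∃ B : Fin k → Finset V, (∀ i, B i ⊆ A) ∧ (∀ i, m ≤ ((B i).card : ℝ)) ∧
      ∀ i j, i ≠ j → Disjoint (B i) (B j) ∧ CompletePair G (B i) (B j) := by
  induction k generalizing A with
  | zero => exact Or.inr ⟨fun i => i.elim0, fun i => i.elim0, fun i => i.elim0, fun i => i.elim0⟩
  | succ k ih =>
    push_cast at hA
    let F := A.powerset.filter fun C => m ≤ (C.card : ℝ) ∧ CompletePair G C (A \ C)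
    have hF : F.Nonempty := by
      refine ⟨A, ?_⟩
      simp only [F, mem_filter, mem_powerset, subset_refl, true_and, sdiff_self]
      refine ⟨?_, fun a _ b hb => by simp at hb⟩
      nlinarith [mul_nonneg (Nat.cast_nonneg (α := ℝ) k) hm.le]
    obtain ⟨C, hC, hmin⟩ := exists_min_image F Finset.card hF
    simp only [F, mem_filter, mem_powerset] at hC hmin
    obtain ⟨hCA, hCm, hCc⟩ := hC
    by_cases hanti : Anticonn G C
    · exact Or.inl ⟨C, hCA, hCm, hanti, hCc⟩
    · simp only [Anticonn] at hanti
      push Not at hanti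
      obtain ⟨C1, h1, hne, hne', hadj⟩ := hanti
      have small : ∀ X ⊆ C, X ≠ C → CompletePair G X (C \ X) → (X.card : ℝ) < m := by
        intro X hX hXC hc
        by_contra hlt
        push Not at hlt
        have := hmin X ⟨hX.trans hCA, hlt, fun a ha b hb => by
          by_cases hbC : b ∈ C
          · exact hc a ha b (mem_sdiff.2 ⟨hbC, (mem_sdiff.1 hb).2⟩)
          · exact hCc a (hX ha) b (mem_sdiff.2 ⟨(mem_sdiff.1 hb).1, hbC⟩)⟩
        exact hXC (eq_of_subset_of_card_le hX this)
      have s1 := small C1 h1 hne' hadj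
      have s2 := small (C \ C1) sdiff_subset (by
        intro h
        obtain ⟨x, hx⟩ := hne
        have : x ∈ C \ C1 := by rw [h]; exact h1 hx
        exact (mem_sdiff.1 this).2 hx) (by
        intro a ha b hb
        rw [Finset.sdiff_sdiff_eq_self h1] at hb
        exact (hadj b hb a ha).symm)
      have hcard : (C.card : ℝ) < 2 * m := by
        have : C1.card + (C \ C1).card = C.card := by
          rw [add_comm]; exact card_sdiff_add_card_eq_card h1
        have h' : (C.card : ℝ) = C1.card + (C \ C1).card := by exact_mod_cast this.symm
        linarith
      have hrest : 2 * k * m ≤ ((A \ C).card : ℝ) := by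
        have : (A \ C).card + C.card = A.card := card_sdiff_add_card_eq_card hCA
        have h' : (A.card : ℝ) = (A \ C).card + C.card := by exact_mod_cast this.symm
        nlinarith
      rcases ih (A \ C) hrest with ⟨D, hD, hDm, hDa, hDc⟩ | ⟨B, hB1, hB2, hB3⟩
      · refine Or.inl ⟨D, hD.trans sdiff_subset, hDm, hDa, ?_⟩
        intro a ha b hb
        by_cases hbC : b ∈ C
        · exact (hCc b hbC a (hD ha)).symm
        · exact hDc a ha b (by simp at hb ⊢; tauto)
      · refine Or.inr ⟨Fin.cons C B, ?_, ?_, ?_⟩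
        · intro i
          refine Fin.cases hCA (fun i => ?_) i
          exact (hB1 i).trans sdiff_subset
        · intro i
          refine Fin.cases hCm (fun i => ?_) i
          exact hB2 i
        · intro i j
          have dj : ∀ i, Disjoint C (B i) := fun i =>
            (disjoint_sdiff (s := C) (t := A)).mono_right (hB1 i)
          have cj : ∀ i, CompletePair G C (B i) := fun i a ha b hb => hCc a ha b (hB1 i hb)
          refine Fin.cases ?_ (fun i => ?_) i <;> refine Fin.cases ?_ (fun j => ?_) j
          · intro h; exact absurd rfl h
          · intro _; exact ⟨dj j, cj j⟩
          · intro _; exact ⟨(dj i).symm, (cj i).symm'⟩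
          · intro h; exact hB3 i j (fun h' => h (by rw [h']))

lemma anticomponent_or_hasBl {V : Type} (G : SimpleGraph V) {m : ℝ} (hm : 0 < m) (k : ℕ) (A : Finset V)
    (hA : 2 * k * m ≤ (A.card : ℝ)) :
    (∃ D ⊆ A, m ≤ (D.card : ℝ) ∧ Anticonn G D) ∨ HasBl G 0 A k m := by
  rcases anticomponent_or_complete G hm k A hA with ⟨D, h1, h2, h3, -⟩ | ⟨B, h1, h2, h3⟩
  · exact Or.inl ⟨D, h1, h2, h3⟩
  · exact Or.inr ⟨Fin k, inferInstance, B, by simp, h1, h2,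
      fun i j hij => ⟨(h3 i j hij).1, Or.inl (h3 i j hij).2⟩⟩

/-- If `u`, `v` are nonadjacent and complete to the anticonnected set `D`, then a neighbour of `u`
which is not a neighbour of `v` is not mixed on `D`. -/
lemma pure_to_anticonn {V : Type} {G : SimpleGraph V} (hG : Free P5ᶜ G) {u v w : V} {D : Finset V}
    (huv : u ≠ v) (nuv : ¬ G.Adj u v) (hD : Anticonn G D) (hu : ∀ a ∈ D, G.Adj u a)
    (hv : ∀ a ∈ D, G.Adj v a) (hw : G.Adj u w) (nw : ¬ G.Adj v w) (hvw : v ≠ w) :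
    (∀ a ∈ D, G.Adj w a) ∨ (∀ a ∈ D, ¬ G.Adj w a) := by
  by_contra hcon
  push Not at hcon
  obtain ⟨⟨x, hx, hxw⟩, ⟨y, hy, hyw⟩⟩ := hcon
  obtain ⟨a, ha, b, hb, hab⟩ := hD (D.filter fun a => G.Adj w a) (filter_subset _ _)
    ⟨y, by simp [hy, hyw]⟩ (by
      intro h
      have : x ∈ D.filter fun a => G.Adj w a := by rw [h]; exact hx
      exact hxw (mem_filter.1 this).2)
  simp only [mem_filter, mem_sdiff, not_and] at ha hb
  have hwb := hb.2 hb.1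
  have hwb' : w ≠ b := by
    rintro rfl; exact nw (hv _ hb.1)
  have hba : b ≠ a := by rintro rfl; exact hwb ha.2
  exact not_house_free_of_path hG huv hvw hwb' hba nuv nw hwb (fun h => hab h.symm)
    hw (hu _ hb.1) (hu _ ha.1) (hv _ hb.1) (hv _ ha.1) ha.2

lemma sum_card_nbrsIn_comm {V : Type} (G : SimpleGraph V) (P Q : Finset V) :
    ∑ p ∈ P, ((nbrsIn G p Q).card : ℝ) = ∑ q ∈ Q, ((nbrsIn G q P).card : ℝ) := by
  have h := sum_card_bipartiteAbove_eq_sum_card_bipartiteBelow (s := P) (t := Q)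
    (fun a b => G.Adj a b)
  have e : ∀ q, P.filter (fun a => G.Adj a q) = nbrsIn G q P := fun q => by
    ext x; simp [nbrsIn, G.adj_comm]
  simp only [bipartiteAbove, bipartiteBelow, e] at h
  exact_mod_cast h

lemma card_sdiff_ge {V : Type} (P Q : Finset V) :
    (P.card : ℝ) - (Q.card : ℝ) ≤ ((P \ Q).card : ℝ) := by
  have : P.card ≤ (P \ Q).card + Q.card := by
    have := le_card_sdiff Q P
    omega
  have h : (P.card : ℝ) ≤ (P \ Q).card + Q.card := by exact_mod_cast this
  linarith

/-- Either deleting few vertices of `W` halves the degrees of `B` into `W`, or there is a long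
sequence of vertices in `B` each having many neighbours not adjacent to the previous ones. -/
lemma halve_or_sequence {V : Type} (G : SimpleGraph V) (W B : Finset V) {h : ℝ} (hh : 0 ≤ h)
    (hB : ∀ b ∈ B, ((nbrsIn G b W).card : ℝ) ≤ h) (N : ℕ) :
    (∃ W' ⊆ W, (W.card : ℝ) - N * h ≤ (W'.card : ℝ) ∧
      ∀ b ∈ B, ((nbrsIn G b W').card : ℝ) ≤ h / 2) ∨
    ∃ (b : ℕ → V) (C : ℕ → Finset V), ∃ W' ⊆ W, (W.card : ℝ) - N * h ≤ (W'.card : ℝ) ∧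
      (∀ i < N, b i ∈ B ∧ C i ⊆ W ∧ (∀ x ∈ C i, G.Adj (b i) x) ∧ h / 2 < ((C i).card : ℝ) ∧
        ∀ x ∈ W', ¬ G.Adj (b i) x) ∧
      ∀ i j, i < j → j < N → ∀ x ∈ C j, ¬ G.Adj (b i) x := by
  induction N with
  | zero =>
    rcases B.eq_empty_or_nonempty with rfl | ⟨v, -⟩
    · exact Or.inl ⟨W, Subset.rfl, by simp, by simp⟩
    · exact Or.inr ⟨fun _ => v, fun _ => ∅, W, Subset.rfl, by simp, by simp, by simp⟩
  | succ N ih =>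
    push_cast
    rcases ih with ⟨W', h1, h2, h3⟩ | ⟨b, C, W', h1, h2, h3, h4⟩
    · exact Or.inl ⟨W', h1, by linarith, h3⟩
    · by_cases hall : ∀ b ∈ B, ((nbrsIn G b W').card : ℝ) ≤ h / 2
      · exact Or.inl ⟨W', h1, by linarith, hall⟩
      push Not at hall
      obtain ⟨v, hv, hvW⟩ := hall
      refine Or.inr ⟨Function.update b N v, Function.update C N (nbrsIn G v W'),
        W' \ nbrsIn G v W, sdiff_subset.trans h1, ?_, ?_, ?_⟩
      · have := card_sdiff_ge W' (nbrsIn G v W)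
        have := hB v hv
        linarith
      · intro i hi
        rcases Nat.lt_succ_iff_lt_or_eq.1 hi with hi | rfl
        · obtain ⟨a1, a2, a3, a4, a5⟩ := h3 i hi
          rw [Function.update_of_ne hi.ne, Function.update_of_ne hi.ne]
          exact ⟨a1, a2, a3, a4, fun x hx => a5 x (mem_sdiff.1 hx).1⟩
        · rw [Function.update_self, Function.update_self]
          refine ⟨hv, (filter_subset _ _).trans h1, fun x hx => (mem_filter.1 hx).2, hvW, ?_⟩
          intro x hx hadj
          obtain ⟨hx1, hx2⟩ := mem_sdiff.1 hx
          exact hx2 (mem_filter.2 ⟨h1 hx1, hadj⟩)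
      · intro i j hij hj x hx
        rw [Function.update_of_ne (by omega)]
        rcases Nat.lt_succ_iff_lt_or_eq.1 hj with hj | rfl
        · rw [Function.update_of_ne hj.ne] at hx
          exact h4 i j hij hj x hx
        · rw [Function.update_self] at hx
          exact (h3 i hij).2.2.2.2 x (mem_filter.1 hx).1

lemma exists_two_colouring (q : ℕ → ℕ → ℝ) (N : ℕ) {H : ℝ}
    (hq : ∀ i < N, ∑ j ∈ range i, q i j ≤ H) :
    ∃ f : ℕ → Bool, ∀ i < N, ∑ j ∈ range i with f j = f i, q i j ≤ H / 2 := by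
  induction N with
  | zero => exact ⟨fun _ => true, by simp⟩
  | succ N ih =>
    obtain ⟨f, hf⟩ := ih fun i hi => hq i (by omega)
    have hsum : ∑ j ∈ range N with f j = true, q N j + ∑ j ∈ range N with f j = false, q N j
        ≤ H := by
      have := sum_filter_add_sum_filter_not (range N) (fun j => f j = true) (q N)
      simp only [Bool.not_eq_true] at this
      rw [this]
      exact hq N (by omega)
    obtain ⟨c, hc⟩ : ∃ c : Bool, ∑ j ∈ range N with f j = c, q N j ≤ H / 2 := by
      by_contra hcon
      push Not at hcon
      have h1 := hcon true
      have h2 := hcon false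
      linarith
    refine ⟨Function.update f N c, fun i hi => ?_⟩
    have key : ∀ i ≤ N, ∀ c', (range i).filter (fun j => Function.update f N c j = c') =
        (range i).filter (fun j => f j = c') := by
      intro i hi c'
      apply filter_congr
      intro j hj
      rw [Function.update_of_ne (by have := mem_range.1 hj; omega)]
    rw [key i (by omega)]
    rcases Nat.lt_succ_iff_lt_or_eq.1 hi with hi | rfl
    · rw [Function.update_of_ne hi.ne]
      exact hf i hi
    · rw [Function.update_self]
      exact hc

/-- A comb can be extracted from a sequence as in `halve_or_sequence`. -/
lemma comb_of_sequence {V : Type} (G : SimpleGraph V) (W : Finset V) {h : ℝ} (hh : 0 < h) (N : ℕ)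
    (b : ℕ → V) (C : ℕ → Finset V) (hb : ∀ i < N, ((nbrsIn G (b i) W).card : ℝ) ≤ h)
    (hC : ∀ i < N, C i ⊆ W ∧ (∀ x ∈ C i, G.Adj (b i) x) ∧ h / 2 < ((C i).card : ℝ))
    (hbC : ∀ i j, i < j → j < N → ∀ x ∈ C j, ¬ G.Adj (b i) x) :
    ∃ I ⊆ range N, ∃ E : ℕ → Finset V, (N : ℝ) / 16 ≤ (I.card : ℝ) ∧
      (∀ i ∈ I, E i ⊆ C i ∧ h / 8 ≤ ((E i).card : ℝ)) ∧
      ∀ i ∈ I, ∀ j ∈ I, i ≠ j → ∀ x ∈ E j, ¬ G.Adj (b i) x := by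
  have hdisj : ∀ i j, i < j → j < N → Disjoint (C i) (C j) := by
    intro i j hij hj
    rw [disjoint_left]
    intro x hx hx'
    exact hbC i j hij hj x hx' ((hC i (hij.trans hj)).2.1 x hx)
  obtain ⟨f, hf⟩ := exists_two_colouring (fun i j => ((nbrsIn G (b i) (C j)).card : ℝ)) N
    (H := h / 2) (by
      intro i hi
      have hu : ((range (i + 1)).biUnion fun j => nbrsIn G (b i) (C j)) ⊆ nbrsIn G (b i) W := by
        intro x hx
        simp only [mem_biUnion, mem_range, nbrsIn, mem_filter] at hx ⊢
        obtain ⟨j, hj, hx, hxa⟩ := hx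
        exact ⟨(hC j (by omega)).1 hx, hxa⟩
      have hcard := card_le_card hu
      rw [card_biUnion] at hcard
      · have h1 : ∑ j ∈ range (i + 1), ((nbrsIn G (b i) (C j)).card : ℝ) ≤ h :=
          le_trans (by exact_mod_cast hcard) (hb i hi)
        rw [sum_range_succ] at h1
        have h2 : nbrsIn G (b i) (C i) = C i := filter_true_of_mem (hC i hi).2.1
        rw [h2] at h1
        have h3 := (hC i hi).2.2
        linarith
      · intro j hj k hk hjk
        have hj' := mem_range.1 hj
        have hk' := mem_range.1 hk
        have : Disjoint (C j) (C k) := by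
          rcases lt_or_gt_of_ne hjk with hlt | hlt
          · exact hdisj j k hlt (by omega)
          · exact (hdisj k j hlt (by omega)).symm
        exact this.mono (filter_subset _ _) (filter_subset _ _))
  let R : ℕ → Finset ℕ := fun j => (range N).filter fun i => j < i ∧ f j = f i
  let r : ℕ → ℝ := fun j => ∑ i ∈ R j, ((nbrsIn G (b i) (C j)).card : ℝ)
  have hr : ∑ j ∈ range N, r j ≤ N * (h / 4) := by
    have : ∑ j ∈ range N, r j =
        ∑ i ∈ range N, ∑ j ∈ range i with f j = f i, ((nbrsIn G (b i) (C j)).card : ℝ) := by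
      apply sum_comm'
      intro i j
      simp only [R, mem_range, mem_filter]
      constructor
      · rintro ⟨h1, h2, h3, h4⟩; exact ⟨⟨h3, h4⟩, h2⟩
      · rintro ⟨⟨h3, h4⟩, h2⟩; exact ⟨by omega, h2, h3, h4⟩
    rw [this]
    calc _ ≤ ∑ i ∈ range N, h / 2 / 2 := sum_le_sum fun i hi => hf i (mem_range.1 hi)
      _ = _ := by rw [sum_const, card_range, nsmul_eq_mul]; ring
  have hr0 : ∀ j, 0 ≤ r j := fun j => sum_nonneg fun i _ => Nat.cast_nonneg _
  let J : Bool → Finset ℕ := fun c => (range N).filter fun j => r j ≤ 3 * h / 8 ∧ f j = c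
  obtain ⟨c, hc⟩ : ∃ c, (N : ℝ) / 16 ≤ ((J c).card : ℝ) := by
    by_contra hcon
    push Not at hcon
    have h1 := hcon true
    have h2 := hcon false
    let L : Finset ℕ := (range N).filter fun j => ¬ r j ≤ 3 * h / 8
    have hL : (L.card : ℝ) * (3 * h / 8) ≤ N * (h / 4) := by
      calc (L.card : ℝ) * (3 * h / 8) = ∑ j ∈ L, 3 * h / 8 := by simp
        _ ≤ ∑ j ∈ L, r j := sum_le_sum fun j hj => (not_le.1 (mem_filter.1 hj).2).le
        _ ≤ ∑ j ∈ range N, r j :=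
          sum_le_sum_of_subset_of_nonneg (filter_subset _ _) fun j _ _ => hr0 j
        _ ≤ _ := hr
    have hcov : range N ⊆ L ∪ (J true ∪ J false) := by
      intro j hj
      simp only [L, J, mem_union, mem_filter, hj, true_and]
      cases f j <;> simp [lt_or_ge]
    have hN := (card_le_card hcov).trans
      ((card_union_le _ _).trans (Nat.add_le_add_left (card_union_le _ _) _))
    rw [card_range] at hN
    have hN' : (N : ℝ) ≤ L.card + ((J true).card + (J false).card) := by exact_mod_cast hN
    nlinarith
  refine ⟨J c, filter_subset _ _, fun j => C j \ (R j).biUnion fun i => nbrsIn G (b i) (C j), hc,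
    ?_, ?_⟩
  · intro j hj
    obtain ⟨hj1, hj2, hj3⟩ := mem_filter.1 hj
    refine ⟨sdiff_subset, ?_⟩
    have h1 := card_sdiff_ge (C j) ((R j).biUnion fun i => nbrsIn G (b i) (C j))
    have h2 : (((R j).biUnion fun i => nbrsIn G (b i) (C j)).card : ℝ) ≤ r j := by
      simp only [r]
      exact_mod_cast card_biUnion_le
    have h3 := (hC j (mem_range.1 hj1)).2.2
    linarith
  · intro i hi j hj hij x hx hadj
    obtain ⟨hi1, hi2, hi3⟩ := mem_filter.1 hi
    obtain ⟨hj1, hj2, hj3⟩ := mem_filter.1 hj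
    obtain ⟨hx1, hx2⟩ := mem_sdiff.1 hx
    rcases lt_or_gt_of_ne hij with hlt | hlt
    · exact hbC i j hlt (mem_range.1 hj1) x hx1 hadj
    · refine hx2 (mem_biUnion.2 ⟨i, ?_, mem_filter.2 ⟨hx1, hadj⟩⟩)
      simp only [R, mem_filter]
      exact ⟨hi1, hlt, hj3.trans hi3.symm⟩

/-- If every vertex of `B` has few neighbours in `A` and every vertex of `A` has many neighbours in
`B`, then there is a comb with apexes in `B` and wide blocks in `A`. -/
lemma exists_comb {V : Type} (G : SimpleGraph V) (A B : Finset V) {n Δ θ : ℝ} (hΔ : 0 < Δ)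
    (hθ : 0 < θ) (hn : (B.card : ℝ) ≤ n) (hB : ∀ b ∈ B, ((nbrsIn G b A).card : ℝ) ≤ Δ)
    (hA : ∀ a ∈ A, θ ≤ ((nbrsIn G a B).card : ℝ)) (hAΔ : 16 * Δ ≤ (A.card : ℝ)) :
    ∃ y : ℝ, (A.card : ℝ) / (16 * Δ) ≤ y ∧ ∃ (I : Finset ℕ) (b : ℕ → V) (E : ℕ → Finset V),
      y / 16 ≤ (I.card : ℝ) ∧
      (∀ i ∈ I, b i ∈ B ∧ E i ⊆ A ∧ (∀ x ∈ E i, G.Adj (b i) x) ∧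
        (A.card : ℝ) ^ 2 / (2048 * Δ * y ^ 2) ≤ ((E i).card : ℝ) ∧
        θ * (A.card : ℝ) / (16 * n) ≤ ((E i).card : ℝ)) ∧
      ∀ i ∈ I, ∀ j ∈ I, i ≠ j → ∀ x ∈ E j, ¬ G.Adj (b i) x := by
  set a : ℝ := (A.card : ℝ) with ha
  set y0 : ℝ := a / (16 * Δ) with hy0
  have hay0 : a = 16 * Δ * y0 := by rw [hy0]; field_simp
  have hy01 : 1 ≤ y0 := by rw [hy0, le_div_iff₀ (by positivity)]; linarith
  have ha0 : 0 < a := by nlinarith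
  by_contra hcon
  have half : ∀ (p : ℕ) (w : ℝ), a - 8 * y0 * Δ * (1 - (3 / 4 : ℝ) ^ p) ≤ w → a / 2 ≤ w := by
    intro p w hw
    have h1 : (0 : ℝ) < (3 / 4) ^ p := by positivity
    have h2 : 8 * y0 * Δ = a / 2 := by rw [hay0]; ring
    rw [h2] at hw
    nlinarith
  have count : ∀ W ⊆ A, ∀ h : ℝ, (∀ b ∈ B, ((nbrsIn G b W).card : ℝ) ≤ h) → a / 2 ≤ (W.card : ℝ) →
      0 ≤ h → θ * a / 2 ≤ n * h := by
    intro W hW h hBW hWa h0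
    have h1 : (W.card : ℝ) * θ ≤ ∑ x ∈ W, ((nbrsIn G x B).card : ℝ) := by
      rw [← nsmul_eq_mul]
      exact card_nsmul_le_sum _ _ _ fun x hx => hA x (hW hx)
    have h2 : ∑ x ∈ B, ((nbrsIn G x W).card : ℝ) ≤ (B.card : ℝ) * h := by
      rw [← nsmul_eq_mul]
      exact sum_le_card_nsmul _ _ _ hBW
    rw [sum_card_nbrsIn_comm] at h1
    have h3 : (B.card : ℝ) * h ≤ n * h := by gcongr
    have h4 : a / 2 * θ ≤ W.card * θ := by gcongr
    linarith
  have main : ∀ p : ℕ, ∃ W ⊆ A, a - 8 * y0 * Δ * (1 - (3 / 4 : ℝ) ^ p) ≤ (W.card : ℝ) ∧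
      ∀ b ∈ B, ((nbrsIn G b W).card : ℝ) ≤ Δ / 2 ^ p := by
    intro p
    induction p with
    | zero => exact ⟨A, Subset.rfl, by rw [pow_zero, sub_self, mul_zero, sub_zero],
      by simpa using hB⟩
    | succ p ih =>
      obtain ⟨W, hWA, hW, hWB⟩ := ih
      have hh : 0 < Δ / 2 ^ p := by positivity
      set y : ℝ := (3 / 2) ^ p * y0 with hy
      have hp1 : (1 : ℝ) ≤ (3 / 2) ^ p := one_le_pow₀ (by norm_num)
      have hy1 : 1 ≤ y := by nlinarith
      have hN : y ≤ (⌈y⌉₊ : ℝ) := Nat.le_ceil y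
      have hN2 : (⌈y⌉₊ : ℝ) ≤ 2 * y := by
        have := Nat.ceil_lt_add_one (by linarith : 0 ≤ y)
        linarith
      have hpq : (3 / 2 : ℝ) ^ p = (3 / 4) ^ p * 2 ^ p := by
        rw [← mul_pow]; norm_num
      rcases halve_or_sequence G W B hh.le hWB ⌈y⌉₊ with
        ⟨W', h1, h2, h3⟩ | ⟨b, C, W', h1, h2, h3, h4⟩
      · refine ⟨W', h1.trans hWA, ?_, ?_⟩
        · have h5 : (⌈y⌉₊ : ℝ) * (Δ / 2 ^ p) ≤ 2 * (3 / 4) ^ p * y0 * Δ := by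
            calc (⌈y⌉₊ : ℝ) * (Δ / 2 ^ p) ≤ 2 * y * (Δ / 2 ^ p) := by gcongr
              _ = _ := by rw [hy, hpq]; field_simp
          rw [pow_succ]
          nlinarith
        · intro v hv
          have := h3 v hv
          rw [pow_succ, ← div_div]
          exact this
      · exfalso
        obtain ⟨I, hI, E, hIc, hE, hbE⟩ := comb_of_sequence G W hh ⌈y⌉₊ b C
          (fun i hi => hWB _ (h3 i hi).1)
          (fun i hi => ⟨(h3 i hi).2.1, (h3 i hi).2.2.1, (h3 i hi).2.2.2.1⟩) h4
        apply hcon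
        refine ⟨y, le_mul_of_one_le_left (by linarith) hp1, I, b, E, by linarith, ?_, hbE⟩
        intro i hi
        obtain ⟨e1, e2⟩ := hE i hi
        obtain ⟨c1, c2, c3, c4, c5⟩ := h3 i (mem_range.1 (hI hi))
        refine ⟨c1, e1.trans (c2.trans hWA), fun x hx => c3 x (e1 hx), ?_, ?_⟩
        · refine le_trans ?_ e2
          have e3 : a ^ 2 / (2048 * Δ * y ^ 2) = Δ / (8 * (9 / 4) ^ p) := by
            have : y ^ 2 = (9 / 4) ^ p * y0 ^ 2 := by
              rw [hy, mul_pow, ← pow_mul, mul_comm p 2, pow_mul]; norm_num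
            rw [this, hay0]
            field_simp
            norm_num
          rw [e3, div_div, mul_comm ((2 : ℝ) ^ p)]
          gcongr
          norm_num
        · refine le_trans ?_ e2
          have e4 := count W hWA _ hWB (half p _ hW) hh.le
          have hn0 : 0 < n := by
            by_contra hn0
            push Not at hn0
            have := mul_pos hθ ha0
            nlinarith
          rw [div_le_iff₀ (by positivity)]
          linarith
  obtain ⟨p, hp⟩ := pow_unbounded_of_one_lt (2 * n * Δ / (θ * a)) (by norm_num : (1 : ℝ) < 2)
  obtain ⟨W, hWA, hW, hWB⟩ := main p
  have h1 := count W hWA _ hWB (half p _ hW) (by positivity)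
  rw [div_lt_iff₀ (mul_pos hθ ha0)] at hp
  have h2 : n * (Δ / 2 ^ p) * 2 ^ p = n * Δ := by field_simp
  have h3 : (0 : ℝ) < 2 ^ p := by positivity
  have h4 : θ * a / 2 * 2 ^ p ≤ n * (Δ / 2 ^ p) * 2 ^ p := by gcongr
  linarith

lemma complete_or_anticomplete {V : Type} {G : SimpleGraph V} {P Q : Finset V}
    (hQ : ∀ q ∈ Q, (∀ p ∈ P, G.Adj q p) ∨ ∀ p ∈ P, ¬ G.Adj q p)
    (hP : ∀ p ∈ P, (∀ q ∈ Q, G.Adj p q) ∨ ∀ q ∈ Q, ¬ G.Adj p q) :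
    CompletePair G P Q ∨ AnticompletePair G P Q := by
  by_cases hcon : ∃ p ∈ P, ∃ q ∈ Q, G.Adj p q
  · obtain ⟨p, hp, q, hq, hpq⟩ := hcon
    left
    intro p' hp' q' hq'
    have h1 : G.Adj q p' := by
      rcases hQ q hq with h | h
      · exact h p' hp'
      · exact absurd hpq.symm (h p hp)
    rcases hP p' hp' with h | h
    · exact h q' hq'
    · exact absurd h1.symm (h q hq)
  · right
    intro p hp q hq hpq
    exact hcon ⟨p, hp, q, hq, hpq⟩

lemma hasBl_of_comb {V : Type} {G : SimpleGraph V} (hG : Free P5ᶜ G) {u : V} {A : Finset V}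
    (hu : ∀ a ∈ A, G.Adj u a) (I : Finset ℕ) (b : ℕ → V) (E : ℕ → Finset V) {m : ℝ} (hm : 0 < m)
    (hb : ∀ i ∈ I, b i ≠ u ∧ ¬ G.Adj u (b i))
    (hE : ∀ i ∈ I, E i ⊆ A ∧ (∀ x ∈ E i, G.Adj (b i) x) ∧ 2 * I.card * m ≤ ((E i).card : ℝ))
    (hbE : ∀ i ∈ I, ∀ j ∈ I, i ≠ j → ∀ x ∈ E j, ¬ G.Adj (b i) x) :
    HasBl G 0 A I.card m := by
  by_cases hall : ∀ i ∈ I, ∃ D ⊆ E i, m ≤ (D.card : ℝ) ∧ Anticonn G D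
  · choose! D hDE hDm hDa using hall
    refine ⟨I, inferInstance, fun i => D i, by simp, fun i => (hDE i i.2).trans (hE i i.2).1,
      fun i => hDm i i.2, ?_⟩
    have pure : ∀ i ∈ I, ∀ j ∈ I, i ≠ j → ∀ w ∈ D j,
        (∀ a ∈ D i, G.Adj w a) ∨ ∀ a ∈ D i, ¬ G.Adj w a := by
      intro i hi j hj hij w hw
      have hwj := hDE j hj hw
      have huw := hu w ((hE j hj).1 hwj)
      refine pure_to_anticonn hG (hb i hi).1.symm (hb i hi).2 (hDa i hi)
        (fun a ha => hu a ((hE i hi).1 (hDE i hi ha)))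
        (fun a ha => (hE i hi).2.1 a (hDE i hi ha)) huw (hbE i hi j hj hij w hwj) ?_
      rintro rfl
      exact (hb i hi).2 huw
    rintro ⟨i, hi⟩ ⟨j, hj⟩ hij
    have hij' : i ≠ j := fun h => hij (by subst h; rfl)
    refine ⟨?_, ?_⟩
    · rw [disjoint_left]
      intro x hx hx'
      exact hbE i hi j hj hij' x (hDE j hj hx') ((hE i hi).2.1 x (hDE i hi hx))
    · rcases complete_or_anticomplete (pure i hi j hj hij') (pure j hj i hi hij'.symm) with h | h
      · exact Or.inl h
      · exact blockRel_of_anticomplete h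
  · push Not at hall
    obtain ⟨i, hi, hno⟩ := hall
    rcases anticomponent_or_hasBl G hm I.card (E i) (hE i hi).2.2 with ⟨D, h1, h2, h3⟩ | h
    · exact absurd h3 (hno D h1 h2)
    · exact h.mono le_rfl (hE i hi).1 le_rfl le_rfl

/-- If `A` is a set of neighbours of `u` and the nonneighbours in `B` of `u` all have few neighbours
in `A`, then half of `A` has few neighbours in `B`, or `A` contains a pure blockade. -/
lemma few_neighbours_or_hasBl {V : Type} {G : SimpleGraph V} (hG : Free P5ᶜ G) {u : V}
    {A B : Finset V} {n Δ θ : ℝ} {K : ℕ} (hK : 2 ≤ K) (hΔ : 0 < Δ) (hθ : 0 < θ)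
    (hn : (B.card : ℝ) ≤ n) (hn0 : 0 < n) (hu : ∀ a ∈ A, G.Adj u a)
    (huB : ∀ b ∈ B, b ≠ u ∧ ¬ G.Adj u b)
    (hB : ∀ b ∈ B, ((nbrsIn G b A).card : ℝ) ≤ Δ) (hAΔ : 1024 * Δ ≤ (A.card : ℝ)) :
    (∃ A' ⊆ A, (A.card : ℝ) / 2 ≤ (A'.card : ℝ) ∧ ∀ a ∈ A', ((nbrsIn G a B).card : ℝ) ≤ θ) ∨
    HasBl G 0 A K (θ * A.card / (64 * n * K)) ∨
    ∃ k : ℕ, 2 ≤ k ∧ k < K ∧ (A.card : ℝ) ≤ 1024 * Δ * k ∧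
      HasBl G 0 A k ((A.card : ℝ) ^ 2 / (2 ^ 24 * Δ * k ^ 3)) := by
  have hA0 : (0 : ℝ) < A.card := by nlinarith
  let A1 := A.filter fun a => θ < ((nbrsIn G a B).card : ℝ)
  have hA1A : A1 ⊆ A := filter_subset _ _
  by_cases hA1 : (A1.card : ℝ) < (A.card : ℝ) / 2
  · refine Or.inl ⟨A \ A1, sdiff_subset, ?_, ?_⟩
    · have := card_sdiff_ge A A1
      linarith
    · intro a ha
      obtain ⟨ha1, ha2⟩ := mem_sdiff.1 ha
      by_contra hcon
      exact ha2 (mem_filter.2 ⟨ha1, not_le.1 hcon⟩)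
  right
  push Not at hA1
  obtain ⟨y, hy, I, b, E, hI, hE, hbE⟩ := exists_comb G A1 B hΔ hθ hn
    (fun v hv => (card_nbrsIn_mono hA1A).trans (hB v hv))
    (fun a ha => (mem_filter.1 ha).2.le) (by linarith)
  have hyA : (A.card : ℝ) ≤ 32 * Δ * y := by
    rw [div_le_iff₀ (by positivity)] at hy
    linarith
  have hy32 : 32 ≤ y := by
    by_contra hcon
    push Not at hcon
    nlinarith
  have ext : ∀ (k : ℕ) (m : ℝ), 0 < m → k ≤ I.card →
      (∀ i ∈ I, 2 * k * m ≤ ((E i).card : ℝ)) → HasBl G 0 A k m := by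
    intro k m hm hk hkm
    obtain ⟨I', hI', rfl⟩ := exists_subset_card_eq hk
    refine hasBl_of_comb hG hu I' b E hm (fun i hi => huB _ (hE i (hI' hi)).1) (fun i hi => ?_)
      fun i hi j hj => hbE i (hI' hi) j (hI' hj)
    obtain ⟨e1, e2, e3, -, -⟩ := hE i (hI' hi)
    exact ⟨e2.trans hA1A, e3, hkm i (hI' hi)⟩
  have hfl : (⌊y / 16⌋₊ : ℝ) ≤ y / 16 := Nat.floor_le (by linarith)
  have hM : ⌊y / 16⌋₊ ≤ I.card := by exact_mod_cast hfl.trans hI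
  by_cases hMK : K ≤ ⌊y / 16⌋₊
  · left
    have hK0 : (0 : ℝ) < K := by exact_mod_cast (by omega : 0 < K)
    refine ext K _ (by positivity) (hMK.trans hM) fun i hi => le_trans ?_ (hE i hi).2.2.2.2
    have : 2 * (K : ℝ) * (θ * A.card / (64 * n * K)) = θ * (A.card / 2) / (16 * n) := by
      field_simp
      norm_num
    rw [this]
    gcongr
  · right
    push Not at hMK
    have hM2 : 2 ≤ ⌊y / 16⌋₊ := Nat.le_floor (by push_cast; linarith)
    set k := ⌊y / 16⌋₊ with hk
    have hk2 : (2 : ℝ) ≤ k := by exact_mod_cast hM2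
    have hyk : y ≤ 32 * k := by
      have := Nat.lt_floor_add_one (y / 16)
      rw [← hk] at this
      linarith
    refine ⟨k, hM2, hMK, ?_, ?_⟩
    · nlinarith
    · refine ext k _ (by positivity) hM fun i hi => le_trans ?_ (hE i hi).2.2.2.1
      have : 2 * (k : ℝ) * ((A.card : ℝ) ^ 2 / (2 ^ 24 * Δ * k ^ 3)) =
          (A.card / 2 : ℝ) ^ 2 / (2048 * Δ * (32 * k) ^ 2) := by
        field_simp
        norm_num
      rw [this]
      gcongr

lemma anticonn_descend {V : Type} (G : SimpleGraph V) {C : Finset V} {v x : V} {m : ℝ}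
    (hC : Anticonn G C) (hm : 0 < m) (hcard : 4 * m ≤ ((nbrsIn G v C).card : ℝ)) (hx : x ∈ C)
    (hvx : ¬ G.Adj v x) :
    (∃ P ⊆ C, ∃ Q ⊆ C, Disjoint P Q ∧ CompletePair G P Q ∧ m ≤ (P.card : ℝ) ∧
      m ≤ (Q.card : ℝ)) ∨
    ∃ C' ⊆ C, m ≤ (C'.card : ℝ) ∧ Anticonn G C' ∧ (∀ c ∈ C', G.Adj v c) ∧
      ∃ w ∈ C, ¬ G.Adj v w ∧ ∃ c ∈ C', ¬ G.Adj w c := by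
  have hNC : nbrsIn G v C ⊆ C := filter_subset _ _
  rcases anticomponent_or_complete G hm 2 (nbrsIn G v C) (by push_cast; linarith) with
    ⟨D, hD, hDm, hDa, hDc⟩ | ⟨B, h1, h2, h3⟩
  · have hDv : ∀ c ∈ D, G.Adj v c := fun c hc => (mem_filter.1 (hD hc)).2
    refine Or.inr ⟨D, hD.trans hNC, hDm, hDa, hDv, ?_⟩
    have hne : D.Nonempty := by
      rw [← card_pos]
      exact_mod_cast hm.trans_le hDm
    have hDC : D ≠ C := by
      intro h
      rw [← h] at hx
      exact hvx (hDv x hx)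
    obtain ⟨c, hc, w, hw, hcw⟩ := hC D (hD.trans hNC) hne hDC
    obtain ⟨hw1, hw2⟩ := mem_sdiff.1 hw
    refine ⟨w, hw1, fun hvw => ?_, c, hc, fun h => hcw h.symm⟩
    exact hcw (hDc c hc w (mem_sdiff.2 ⟨mem_filter.2 ⟨hw1, hvw⟩, hw2⟩))
  · obtain ⟨d, c⟩ := h3 0 1 (by decide)
    exact Or.inl ⟨B 0, (h1 0).trans hNC, B 1, (h1 1).trans hNC, d, c, h2 0, h2 1⟩

/-- A house-free graph in which all degrees are very large has a large complete pair. -/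
lemma complete_pair_of_cosparse {V : Type} {G : SimpleGraph V} (hG : Free P5ᶜ G) {S : Finset V}
    (hS : S.Nonempty)
    (hdeg : ∀ v ∈ S, ((S.filter fun x => ¬ G.Adj v x).card : ℝ) ≤ S.card / 2 ^ 20) :
    ∃ P ⊆ S, ∃ Q ⊆ S, Disjoint P Q ∧ CompletePair G P Q ∧ (S.card : ℝ) / 2 ^ 10 ≤ (P.card : ℝ) ∧
      (S.card : ℝ) / 2 ^ 10 ≤ (Q.card : ℝ) := by
  have hs : (0 : ℝ) < S.card := by exact_mod_cast hS.card_pos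
  set s : ℝ := (S.card : ℝ) with hs_def
  by_contra hcon
  have nopair : ∀ C ⊆ S, ∀ m : ℝ, s / 2 ^ 10 ≤ m → ¬ ∃ P ⊆ C, ∃ Q ⊆ C, Disjoint P Q ∧
      CompletePair G P Q ∧ m ≤ (P.card : ℝ) ∧ m ≤ (Q.card : ℝ) := by
    rintro C hC m hm ⟨P, hP, Q, hQ, h1, h2, h3, h4⟩
    exact hcon ⟨P, hP.trans hC, Q, hQ.trans hC, h1, h2, hm.trans h3, hm.trans h4⟩
  have hnb : ∀ v ∈ S, ∀ C ⊆ S, (C.card : ℝ) - s / 2 ^ 20 ≤ ((nbrsIn G v C).card : ℝ) := by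
    intro v hv C hC
    have h1 := card_filter_add_card_filter_not (s := C) (fun x => G.Adj v x)
    have h2 : ((C.filter fun x => ¬ G.Adj v x).card : ℝ) ≤ s / 2 ^ 20 :=
      le_trans (by exact_mod_cast card_le_card (filter_subset_filter _ hC)) (hdeg v hv)
    have h3 : ((nbrsIn G v C).card : ℝ) + ((C.filter fun x => ¬ G.Adj v x).card : ℝ) = C.card := by
      exact_mod_cast h1
    linarith
  obtain ⟨C0, hC0, c0, a0⟩ : ∃ C0 ⊆ S, s / 4 ≤ (C0.card : ℝ) ∧ Anticonn G C0 := by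
    rcases anticomponent_or_complete G (by positivity : 0 < s / 4) 2 S
      (by push_cast; linarith) with ⟨D, hD, hDm, hDa, -⟩ | ⟨B, h1, h2, h3⟩
    · exact ⟨D, hD, hDm, hDa⟩
    · obtain ⟨d, c⟩ := h3 0 1 (by decide)
      exact absurd ⟨B 0, h1 0, B 1, h1 1, d, c, h2 0, h2 1⟩ (nopair S Subset.rfl _ (by linarith))
  obtain ⟨v1, hv1⟩ : C0.Nonempty := by
    rw [← card_pos]
    have : (0 : ℝ) < C0.card := by linarith
    exact_mod_cast this
  obtain ⟨C1, hC1, c1, a1, n1, v2, hv2, h12, x2, hx2, hvx2⟩ :=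
    (anticonn_descend G (m := s / 20) a0 (by positivity)
      (by have := hnb v1 (hC0 hv1) C0 hC0; linarith) hv1 (G.loopless.irrefl v1)).resolve_left
      (nopair C0 hC0 _ (by linarith))
  have hC1S := hC1.trans hC0
  obtain ⟨C2, hC2, c2, a2, n2, v3, hv3, h23, x3, hx3, hvx3⟩ :=
    (anticonn_descend G (m := s / 100) a1 (by positivity)
      (by have := hnb v2 (hC0 hv2) C1 hC1S; linarith) hx2 hvx2).resolve_left
      (nopair C1 hC1S _ (by linarith))
  have hC2S := hC2.trans hC1S
  obtain ⟨C3, hC3, c3, a3, n3, v4, hv4, h34, v5, hv5, h45⟩ :=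
    (anticonn_descend G (m := s / 500) a2 (by positivity)
      (by have := hnb v3 (hC1S hv3) C2 hC2S; linarith) hx3 hvx3).resolve_left
      (nopair C2 hC2S _ (by linarith))
  refine not_house_free_of_path hG (a := v1) (b := v2) (c := v3) (d := v4) (e := v5)
    ?_ ?_ ?_ ?_ h12 h23 h34 h45 (n1 _ hv3) (n1 _ (hC2 hv4)) (n1 _ (hC2 (hC3 hv5)))
    (n2 _ hv4) (n2 _ (hC3 hv5)) (n3 _ hv5)
  · rintro rfl; exact hvx2 (n1 _ hx2)
  · rintro rfl; exact hvx3 (n2 _ hx3)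
  · rintro rfl; exact h45 (n3 _ hv5)
  · rintro rfl; exact h34 (n3 _ hv5)

lemma card_filter_mul_le_sum {α : Type*} (P : Finset α) (f : α → ℝ) (hf : ∀ x ∈ P, 0 ≤ f x)
    (t : ℝ) : ((P.filter fun x => t < f x).card : ℝ) * t ≤ ∑ x ∈ P, f x := by
  calc ((P.filter fun x => t < f x).card : ℝ) * t = ∑ x ∈ P.filter fun x => t < f x, t := by simp
    _ ≤ ∑ x ∈ P.filter fun x => t < f x, f x := sum_le_sum fun x hx => (mem_filter.1 hx).2.le
    _ ≤ _ := sum_le_sum_of_subset_of_nonneg (filter_subset _ _) fun x hx _ => hf x hx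

lemma card_filter_le_add_card_filter_lt {α : Type*} (P : Finset α) (f : α → ℝ) (t : ℝ) :
    ((P.filter fun x => f x ≤ t).card : ℝ) + ((P.filter fun x => t < f x).card : ℝ) = P.card := by
  have := card_filter_add_card_filter_not (s := P) (fun x => f x ≤ t)
  simp only [not_le] at this
  exact_mod_cast this

/-- A vertex `v` with many nonadjacent pairs between its neighbours and nonneighbours yields a
blockade. -/
lemma hasBl_of_many_nonedges {V : Type} {G : SimpleGraph V} (hG : Free P5ᶜ G) {S : Finset V}
    {n θ : ℝ} {K : ℕ} (hK : 2 ≤ K) (hθ : 0 < θ) (hS : S.Nonempty) (hn : (S.card : ℝ) ≤ n) {v : V}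
    (hv : (S.card : ℝ) ^ 2 / 2 ^ 65 < ∑ y ∈ S.filter fun y => ¬ G.Adj v y,
      ((nbrsIn G v (S.filter fun x => ¬ G.Adj y x)).card : ℝ)) :
    HasBl G 0 S K (θ * S.card / (2 ^ 71 * n * K)) ∨
    ∃ k : ℕ, 2 ≤ k ∧ k ≤ K ∧ HasBl G θ S k (S.card / k ^ 90) := by
  have hs : (0 : ℝ) < S.card := by exact_mod_cast hS.card_pos
  set s : ℝ := (S.card : ℝ) with hs_def
  have hn0 : 0 < n := hs.trans_le hn
  have hK0 : (0 : ℝ) < K := by exact_mod_cast (by omega : 0 < K)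
  set A := nbrsIn G v S with hA
  have hAS : A ⊆ S := filter_subset _ _
  have hvA : ∀ a ∈ A, G.Adj v a := fun a ha => (mem_filter.1 ha).2
  set M := S.filter fun y => ¬ G.Adj v y with hM
  let g : V → ℝ := fun y => ((nbrsIn G v (S.filter fun x => ¬ G.Adj y x)).card : ℝ)
  have hgA : ∀ y, g y ≤ (A.card : ℝ) := fun y => card_nbrsIn_mono (filter_subset _ _)
  have hMs : (M.card : ℝ) ≤ s := Nat.cast_le.2 (card_le_card (filter_subset _ _))
  have hAs : (A.card : ℝ) ≤ s := Nat.cast_le.2 (card_le_card hAS)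
  have hAcard : s / 2 ^ 65 ≤ (A.card : ℝ) := by
    have h1 : ∑ y ∈ M, g y ≤ M.card * (A.card : ℝ) := by
      rw [← nsmul_eq_mul]; exact sum_le_card_nsmul _ _ _ fun y _ => hgA y
    have h2 : M.card * (A.card : ℝ) ≤ s * A.card := by gcongr
    have h3 : s * (s / 2 ^ 65) < s * A.card := by
      calc s * (s / 2 ^ 65) = s ^ 2 / 2 ^ 65 := by ring
        _ < _ := hv.trans_le (h1.trans h2)
    exact (lt_of_mul_lt_mul_left h3 hs.le).le
  set B := M.filter fun y => s / 2 ^ 66 < g y with hB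
  have hBS : B ⊆ S := (filter_subset _ _).trans (filter_subset _ _)
  have hBcard : s / 2 ^ 66 ≤ (B.card : ℝ) := by
    have h0 : ∑ y ∈ B, g y + ∑ y ∈ M with ¬ s / 2 ^ 66 < g y, g y = ∑ y ∈ M, g y := by
      rw [hB]
      convert sum_filter_add_sum_filter_not M (fun y => s / 2 ^ 66 < g y) g
    have h1 : ∑ y ∈ B, g y ≤ B.card * s := by
      rw [← nsmul_eq_mul]; exact sum_le_card_nsmul _ _ _ fun y _ => (hgA y).trans hAs
    have h2 : ∑ y ∈ M with ¬ s / 2 ^ 66 < g y, g y ≤ s * (s / 2 ^ 66) := by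
      calc _ ≤ ((M.filter fun y => ¬ s / 2 ^ 66 < g y).card : ℝ) * (s / 2 ^ 66) := by
            rw [← nsmul_eq_mul]
            exact sum_le_card_nsmul _ _ _ fun y hy => not_lt.1 (mem_filter.1 hy).2
        _ ≤ M.card * (s / 2 ^ 66) := by
            gcongr
            exact filter_subset _ _
        _ ≤ _ := by gcongr
    have h3 : (s / 2 ^ 66) * s < B.card * s := by
      have h4 : s ^ 2 / 2 ^ 65 < ∑ y ∈ M, g y := hv
      have h5 : s ^ 2 / 2 ^ 65 = s * (s / 2 ^ 66) + (s / 2 ^ 66) * s := by ring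
      linarith
    exact (lt_of_mul_lt_mul_right h3 hs.le).le
  have hBv : ∀ b ∈ B, b ≠ v ∧ ¬ G.Adj v b := by
    intro b hb
    obtain ⟨hb1, hb2⟩ := mem_filter.1 hb
    refine ⟨?_, (mem_filter.1 hb1).2⟩
    rintro rfl
    have : g b = 0 := by
      simp only [g, Nat.cast_eq_zero, card_eq_zero, nbrsIn, filter_filter, filter_eq_empty_iff]
      intro x _ hx
      exact hx.1 hx.2
    rw [this] at hb2
    have : 0 < s / 2 ^ 66 := by positivity
    linarith
  have two : ∀ w : ℝ, s / 2 ^ 90 ≤ w → ∀ θ' ≤ θ, HasBl G θ' S 2 w →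
      ∃ k : ℕ, 2 ≤ k ∧ k ≤ K ∧ HasBl G θ S k (s / k ^ 90) := fun w hw θ' hθ' h =>
    ⟨2, le_rfl, hK, h.mono hθ' Subset.rfl (by norm_num) (by push_cast; exact hw)⟩
  by_cases hlow : ∀ y ∈ B, ((nbrsIn G y A).card : ℝ) ≤ s / 2 ^ 75
  · rcases few_neighbours_or_hasBl hG hK (by positivity : 0 < s / 2 ^ 75) hθ
      (le_trans (Nat.cast_le.2 (card_le_card hBS)) hn) hn0 hvA hBv hlow (by linarith) with
      ⟨A', h1, h2, h3⟩ | h | ⟨k, h1, h2, h3, h4⟩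
    · right
      refine two (s / 2 ^ 66) (by gcongr <;> norm_num) θ le_rfl
        (hasBl_pair (h1.trans hAS) hBS ?_ (Or.inr (Or.inl h3)) (by linarith) hBcard)
      rw [disjoint_left]
      intro x hx hx'
      exact (hBv x hx').2 (hvA x (h1 hx))
    · left
      refine h.mono le_rfl hAS le_rfl ?_
      calc θ * s / (2 ^ 71 * n * K) = θ * (s / 2 ^ 65) / (64 * n * K) := by field_simp; norm_num
        _ ≤ _ := by gcongr
    · right
      refine ⟨k, h1, h2.le, h4.mono hθ.le hAS le_rfl ?_⟩
      have hk : (2 : ℝ) ≤ k := by exact_mod_cast h1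
      calc s / k ^ 90 = s / (k ^ 87 * k ^ 3) := by rw [← pow_add]
        _ ≤ s / (2 ^ 79 * k ^ 3) := by
          have h6 : (2 : ℝ) ^ 79 ≤ k ^ 87 :=
            (pow_le_pow_right₀ (by norm_num) (by norm_num)).trans
              (pow_le_pow_left₀ (by norm_num) hk 87)
          gcongr
        _ = (s / 2 ^ 65) ^ 2 / (2 ^ 24 * (s / 2 ^ 75) * k ^ 3) := by
          have : (k : ℝ) ≠ 0 := by positivity
          field_simp
        _ ≤ _ := by gcongr
  · right
    push Not at hlow
    obtain ⟨y, hy, hyA⟩ := hlow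
    have hNA : nbrsIn G y A ⊆ A := filter_subset _ _
    rcases anticomponent_or_hasBl G (by positivity : 0 < s / 2 ^ 77) 2 (nbrsIn G y A)
      (by push_cast; linarith) with ⟨D, hD, hDm, hDa⟩ | h
    · set X := nbrsIn G v (S.filter fun x => ¬ G.Adj y x) with hX
      have hXcard : s / 2 ^ 66 < (X.card : ℝ) := (mem_filter.1 hy).2
      have hXm : ∀ x ∈ X, x ∈ S ∧ ¬ G.Adj y x ∧ G.Adj v x := by
        intro x hx
        obtain ⟨hx1, hx2⟩ := mem_filter.1 hx
        exact ⟨(mem_filter.1 hx1).1, (mem_filter.1 hx1).2, hx2⟩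
      have hDX : Disjoint D X := by
        rw [disjoint_left]
        intro x hx hx'
        exact (hXm x hx').2.1 (mem_filter.1 (hD hx)).2
      have hpure : ∀ x ∈ X, (∀ a ∈ D, G.Adj x a) ∨ ∀ a ∈ D, ¬ G.Adj x a := by
        intro x hx
        obtain ⟨-, hx2, hx3⟩ := hXm x hx
        refine pure_to_anticonn hG (hBv y hy).1.symm (hBv y hy).2 hDa
          (fun a ha => hvA a (hNA (hD ha))) (fun a ha => (mem_filter.1 (hD ha)).2) hx3 hx2 ?_
        rintro rfl
        exact (hBv y hy).2 hx3
      have hsum := card_filter_add_card_filter_not (s := X) (fun x => ∀ a ∈ D, G.Adj x a)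
      set X1 := X.filter fun x => ∀ a ∈ D, G.Adj x a with hX1
      set X2 := X.filter fun x => ¬ ∀ a ∈ D, G.Adj x a with hX2
      have hsum' : (X1.card : ℝ) + X2.card = X.card := by exact_mod_cast hsum
      have hDS : D ⊆ S := hD.trans (hNA.trans hAS)
      have hXS : X ⊆ S := fun x hx => (hXm x hx).1
      have fin : ∀ Y ⊆ X, s / 2 ^ 77 ≤ (Y.card : ℝ) → BlockRel G 0 D Y →
          ∃ k : ℕ, 2 ≤ k ∧ k ≤ K ∧ HasBl G θ S k (s / k ^ 90) := fun Y hY hYc hr =>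
        two (s / 2 ^ 77) (by gcongr <;> norm_num) 0 hθ.le
          (hasBl_pair hDS (hY.trans hXS) (hDX.mono_right hY) hr hDm hYc)
      by_cases hX1c : s / 2 ^ 77 ≤ (X1.card : ℝ)
      · exact fin X1 (filter_subset _ _) hX1c
          (Or.inl fun a ha b hb => ((mem_filter.1 hb).2 a ha).symm)
      · refine fin X2 (filter_subset _ _) (by linarith) (blockRel_of_anticomplete ?_)
        intro a ha b hb hab
        obtain ⟨hb1, hb2⟩ := mem_filter.1 hb
        exact ((hpure b hb1).resolve_left hb2) a ha hab.symm
    · exact two (s / 2 ^ 77) (by gcongr <;> norm_num) 0 hθ.le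
        (h.mono le_rfl (hNA.trans hAS) (by norm_num) le_rfl)

/-- Every set of vertices contains a blockade or a large subset inducing a sparse subgraph. -/
lemma sparse_subset_or_hasBl {V : Type} {G : SimpleGraph V} (hG : Free P5ᶜ G) {S : Finset V}
    {n θ : ℝ} {K : ℕ} (hK : 2 ≤ K) (hθ : 0 < θ) (hS : S.Nonempty) (hn : (S.card : ℝ) ≤ n) :
    HasBl G 0 S K (θ * S.card / (2 ^ 71 * n * K)) ∨
    (∃ k : ℕ, 2 ≤ k ∧ k ≤ K ∧ HasBl G θ S k (S.card / k ^ 90)) ∨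
    ∃ T ⊆ S, (S.card : ℝ) / 2 ^ 22 ≤ T.card ∧
      ∀ v ∈ T, ((nbrsIn G v T).card : ℝ) ≤ T.card / 2 ^ 20 := by
  by_cases hex : ∃ v ∈ S, (S.card : ℝ) ^ 2 / 2 ^ 65 < ∑ y ∈ S.filter fun y => ¬ G.Adj v y,
      ((nbrsIn G v (S.filter fun x => ¬ G.Adj y x)).card : ℝ)
  · obtain ⟨v, -, hv⟩ := hex
    rcases hasBl_of_many_nonedges hG hK hθ hS hn hv with h | h
    · exact Or.inl h
    · exact Or.inr (Or.inl h)
  right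
  push Not at hex
  have hs : (0 : ℝ) < S.card := by exact_mod_cast hS.card_pos
  set s : ℝ := (S.card : ℝ) with hs_def
  let M : V → Finset V := fun y => S.filter fun x => ¬ G.Adj y x
  let P : V → ℝ := fun y => ∑ v ∈ M y, ((nbrsIn G v (M y)).card : ℝ)
  have hP0 : ∀ y, 0 ≤ P y := fun y => sum_nonneg fun _ _ => Nat.cast_nonneg _
  have hPsum : ∑ y ∈ S, P y ≤ s * (s ^ 2 / 2 ^ 65) := by
    have : ∑ y ∈ S, P y = ∑ v ∈ S, ∑ y ∈ S.filter fun y => ¬ G.Adj v y,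
        ((nbrsIn G v (M y)).card : ℝ) := by
      apply sum_comm'
      intro x y
      simp only [M, mem_filter, G.adj_comm]
      tauto
    rw [this, hs_def, ← nsmul_eq_mul]
    exact sum_le_card_nsmul _ _ _ hex
  set T := S.filter fun y => P y ≤ s ^ 2 / 2 ^ 64 with hT
  have hTcard : s / 2 ≤ (T.card : ℝ) := by
    have h1 := card_filter_mul_le_sum S P (fun y _ => hP0 y) (s ^ 2 / 2 ^ 64)
    have h2 := card_filter_le_add_card_filter_lt S P (s ^ 2 / 2 ^ 64)
    rw [← hs_def, ← hT] at h2
    have h3 : ((S.filter fun y => s ^ 2 / 2 ^ 64 < P y).card : ℝ) ≤ s / 2 := by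
      have h4 : ((S.filter fun y => s ^ 2 / 2 ^ 64 < P y).card : ℝ) * (s ^ 2 / 2 ^ 64) ≤
          s / 2 * (s ^ 2 / 2 ^ 64) := by
        calc _ ≤ _ := h1.trans hPsum
          _ = _ := by ring
      exact le_of_mul_le_mul_right h4 (by positivity)
    linarith
  by_cases hbig : ∃ y ∈ T, s / 2 ^ 21 ≤ ((M y).card : ℝ)
  · obtain ⟨y, hy, hyM⟩ := hbig
    right
    have hPy : P y ≤ s ^ 2 / 2 ^ 64 := (mem_filter.1 hy).2
    have hM0 : 0 < ((M y).card : ℝ) := lt_of_lt_of_le (by positivity) hyM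
    set t : ℝ := 2 * (s ^ 2 / 2 ^ 64) / (M y).card with ht
    have ht0 : 0 < t := by positivity
    set T' := (M y).filter fun v => ((nbrsIn G v (M y)).card : ℝ) ≤ t with hT'
    have hT'card : ((M y).card : ℝ) / 2 ≤ T'.card := by
      have h1 := card_filter_mul_le_sum (M y) (fun v => ((nbrsIn G v (M y)).card : ℝ))
        (fun _ _ => Nat.cast_nonneg _) t
      have h2 := card_filter_le_add_card_filter_lt (M y) (fun v => ((nbrsIn G v (M y)).card : ℝ)) t
      have h3 : (((M y).filter fun v => t < ((nbrsIn G v (M y)).card : ℝ)).card : ℝ) * t ≤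
          (M y).card / 2 * t := by
        calc _ ≤ s ^ 2 / 2 ^ 64 := h1.trans hPy
          _ = _ := by rw [ht]; field_simp
      have h4 := le_of_mul_le_mul_right h3 ht0
      linarith
    refine ⟨T', (filter_subset _ _).trans (filter_subset _ _), by linarith, fun v hv => ?_⟩
    calc ((nbrsIn G v T').card : ℝ) ≤ (nbrsIn G v (M y)).card :=
          card_nbrsIn_mono (filter_subset _ _)
      _ ≤ t := (mem_filter.1 hv).2
      _ ≤ 2 * (s ^ 2 / 2 ^ 64) / (s / 2 ^ 21) := by rw [ht]; gcongr
      _ = s / 2 ^ 42 := by field_simp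
      _ ≤ _ := by linarith
  · left
    push Not at hbig
    have hTS : T ⊆ S := filter_subset _ _
    have hTne : T.Nonempty := by
      rw [← card_pos]
      have : (0 : ℝ) < T.card := by linarith
      exact_mod_cast this
    obtain ⟨Q, hQ, R, hR, h1, h2, h3, h4⟩ := complete_pair_of_cosparse hG hTne (by
      intro v hv
      have h1 := hbig v hv
      have h2 : ((T.filter fun x => ¬ G.Adj v x).card : ℝ) ≤ (M v).card :=
        Nat.cast_le.2 (card_le_card (filter_subset_filter _ hTS))
      linarith)
    refine ⟨2, le_rfl, hK, ?_⟩
    refine HasBl.mono (hasBl_pair (hQ.trans hTS) (hR.trans hTS) h1 (Or.inl h2) h3 h4)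
      le_rfl Subset.rfl (by norm_num) ?_
    calc s / ((2 : ℕ) : ℝ) ^ 90 ≤ s / 2 / 2 ^ 10 := by
          rw [div_div]; push_cast; gcongr; norm_num
      _ ≤ _ := by gcongr

lemma cut_or_hasBl {V : Type} {G : SimpleGraph V} (hG : Free P5ᶜ G) {W : Finset V}
    {n θ Δ h : ℝ} {K : ℕ} (hK : 2 ≤ K) (hθ : 0 < θ) (hn : (W.card : ℝ) ≤ n) (hΔ : 1 ≤ Δ)
    (hh : 0 < h) (hh1 : h ≤ 1 / 2 ^ 10) (hdeg : ∀ v ∈ W, ((nbrsIn G v W).card : ℝ) ≤ Δ) {u : V}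
    (hu : u ∈ W) (huW : Δ / 64 ≤ ((nbrsIn G u W).card : ℝ)) :
    (∃ A ⊆ W, ∃ B ⊆ W, Disjoint A B ∧ Δ / 128 ≤ (A.card : ℝ) ∧
      (W.card : ℝ) - 3 * (Δ / h) ≤ (B.card : ℝ) ∧ ∀ a ∈ A, ((nbrsIn G a B).card : ℝ) ≤ θ) ∨
    HasBl G 0 W K (θ * Δ / (2 ^ 12 * n * K)) ∨
    ∃ k : ℕ, 2 ≤ k ∧ k < K ∧ 1 ≤ 1024 * h * k ∧ HasBl G 0 W k (Δ / (2 ^ 30 * h * k ^ 3)) := by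
  have hK0 : (0 : ℝ) < K := by exact_mod_cast (by omega : 0 < K)
  have hn0 : 0 < n := lt_of_lt_of_le (by exact_mod_cast card_pos.2 ⟨u, hu⟩) hn
  set A := nbrsIn G u W with hA
  have hAW : A ⊆ W := filter_subset _ _
  have hA0 : 0 < (A.card : ℝ) := by linarith
  have huA : ∀ a ∈ A, G.Adj u a := fun a ha => (mem_filter.1 ha).2
  set B := W.filter fun v => v ≠ u ∧ ¬ G.Adj u v ∧ ((nbrsIn G v A).card : ℝ) ≤ h * A.card with hB
  have hBW : B ⊆ W := filter_subset _ _
  let Z := W.filter fun v => h * A.card < ((nbrsIn G v A).card : ℝ)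
  have hZ : (Z.card : ℝ) ≤ Δ / h := by
    have h1 := card_filter_mul_le_sum W (fun v => ((nbrsIn G v A).card : ℝ))
      (fun _ _ => Nat.cast_nonneg _) (h * A.card)
    rw [sum_card_nbrsIn_comm] at h1
    have h2 : ∑ a ∈ A, ((nbrsIn G a W).card : ℝ) ≤ A.card * Δ := by
      rw [← nsmul_eq_mul]
      exact sum_le_card_nsmul _ _ _ fun a ha => hdeg a (hAW ha)
    rw [le_div_iff₀ hh]
    have h3 : (Z.card * h) * (A.card : ℝ) ≤ Δ * A.card := by
      calc _ = Z.card * (h * A.card) := by ring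
        _ ≤ _ := h1
        _ ≤ _ := h2
        _ = _ := by ring
    exact le_of_mul_le_mul_right h3 hA0
  have hBcard : (W.card : ℝ) - 3 * (Δ / h) ≤ (B.card : ℝ) := by
    have hcov : W ⊆ B ∪ ({u} ∪ (A ∪ Z)) := by
      intro v hv
      by_cases h1 : v = u
      · simp [h1]
      by_cases h2 : G.Adj u v
      · have : v ∈ A := mem_filter.2 ⟨hv, h2⟩
        simp [this]
      by_cases h3 : ((nbrsIn G v A).card : ℝ) ≤ h * A.card
      · have : v ∈ B := mem_filter.2 ⟨hv, h1, h2, h3⟩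
        simp [this]
      · have : v ∈ Z := mem_filter.2 ⟨hv, not_le.1 h3⟩
        simp [this]
    have h1 := (card_le_card hcov).trans ((card_union_le _ _).trans (Nat.add_le_add_left
      ((card_union_le _ _).trans (Nat.add_le_add_left (card_union_le _ _) _)) _))
    rw [card_singleton] at h1
    have h2 : (W.card : ℝ) ≤ B.card + (1 + (A.card + Z.card)) := by exact_mod_cast h1
    have h3 : Δ ≤ Δ / h := by
      rw [le_div_iff₀ hh]
      nlinarith
    have h4 := hdeg u hu
    linarith
  rcases few_neighbours_or_hasBl hG hK (by positivity : 0 < h * A.card) hθ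
    (le_trans (Nat.cast_le.2 (card_le_card hBW)) hn) hn0 huA
    (fun b hb => ⟨(mem_filter.1 hb).2.1, (mem_filter.1 hb).2.2.1⟩)
    (fun b hb => (mem_filter.1 hb).2.2.2) (by nlinarith) with
    ⟨A', h1, h2, h3⟩ | h1 | ⟨k, h1, h2, h3, h4⟩
  · refine Or.inl ⟨A', h1.trans hAW, B, hBW, ?_, by linarith, hBcard, h3⟩
    rw [disjoint_left]
    intro x hx hx'
    exact (mem_filter.1 hx').2.2.1 (huA x (h1 hx))
  · refine Or.inr (Or.inl (h1.mono le_rfl hAW le_rfl ?_))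
    calc θ * Δ / (2 ^ 12 * n * K) = θ * (Δ / 64) / (64 * n * K) := by field_simp; norm_num
      _ ≤ _ := by gcongr
  · refine Or.inr (Or.inr ⟨k, h1, h2, ?_, h4.mono le_rfl hAW le_rfl ?_⟩)
    · have : 1 * (A.card : ℝ) ≤ 1024 * h * k * A.card := by linarith
      exact le_of_mul_le_mul_right this hA0
    · have hk : (0 : ℝ) < k := by exact_mod_cast (by omega : 0 < k)
      calc Δ / (2 ^ 30 * h * k ^ 3) = (Δ / 64) / (2 ^ 24 * h * k ^ 3) := by
            field_simp; norm_num
        _ ≤ A.card / (2 ^ 24 * h * k ^ 3) := by gcongr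
        _ = _ := by field_simp

/-- Iterating `cut_or_hasBl`. -/
lemma cuts_or_hasBl {V : Type} {G : SimpleGraph V} (hG : Free P5ᶜ G) {W : Finset V}
    {n θ Δ h : ℝ} {K : ℕ} (hK : 2 ≤ K) (hθ : 0 < θ) (hn : (W.card : ℝ) ≤ n) (hΔ : 1 ≤ Δ)
    (hh : 0 < h) (hh1 : h ≤ 1 / 2 ^ 10) (hdeg : ∀ v ∈ W, ((nbrsIn G v W).card : ℝ) ≤ Δ)
    (hlarge : ∀ W' ⊆ W, (W.card : ℝ) / 2 ≤ W'.card →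
      ∃ u ∈ W', Δ / 64 ≤ ((nbrsIn G u W').card : ℝ)) {J : ℕ}
    (hJ : 6 * (Δ / h) * J ≤ W.card) :
    HasBl G θ W J (Δ / 128) ∨ HasBl G 0 W K (θ * Δ / (2 ^ 12 * n * K)) ∨
    ∃ k : ℕ, 2 ≤ k ∧ k < K ∧ 1 ≤ 1024 * h * k ∧ HasBl G 0 W k (Δ / (2 ^ 30 * h * k ^ 3)) := by
  by_contra hcon
  push Not at hcon
  obtain ⟨hc1, hc2, hc3⟩ := hcon
  have main : ∀ j ≤ J, ∃ (B : ℕ → Finset V), ∃ W' ⊆ W,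
      (W.card : ℝ) - 3 * (Δ / h) * j ≤ W'.card ∧
      (∀ i < j, B i ⊆ W ∧ Δ / 128 ≤ ((B i).card : ℝ) ∧ Disjoint (B i) W' ∧
        ∀ a ∈ B i, ((nbrsIn G a W').card : ℝ) ≤ θ) ∧
      ∀ i i', i < i' → i' < j → Disjoint (B i) (B i') ∧ BlockRel G θ (B i) (B i') := by
    intro j
    induction j with
    | zero => exact fun _ => ⟨fun _ => ∅, W, Subset.rfl, by simp, by simp, by simp⟩
    | succ j ih =>
      intro hj
      obtain ⟨B, W', hW', h1, h2, h3⟩ := ih (by omega)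
      have hjJ : (j : ℝ) ≤ J := by exact_mod_cast (by omega : j ≤ J)
      have h0 : 3 * (Δ / h) * j ≤ 3 * (Δ / h) * J := by gcongr
      obtain ⟨u, hu, huW⟩ := hlarge W' hW' (by linarith)
      rcases cut_or_hasBl hG hK hθ (le_trans (Nat.cast_le.2 (card_le_card hW')) hn) hΔ hh hh1
        (fun v hv => (card_nbrsIn_mono hW').trans (hdeg v (hW' hv))) hu huW with
        ⟨A, hA, C, hC, a1, a2, a3, a4⟩ | hb | ⟨k, b1, b2, b3, b4⟩
      · refine ⟨Function.update B j A, C, hC.trans hW', ?_, ?_, ?_⟩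
        · push_cast; linarith
        · intro i hi
          rcases Nat.lt_succ_iff_lt_or_eq.1 hi with hi | rfl
          · rw [Function.update_of_ne hi.ne]
            obtain ⟨c1, c2, c3, c4⟩ := h2 i hi
            exact ⟨c1, c2, c3.mono_right hC, fun a ha => (card_nbrsIn_mono hC).trans (c4 a ha)⟩
          · rw [Function.update_self]
            exact ⟨hA.trans hW', a2, a1, a4⟩
        · intro i i' hii hi'
          rw [Function.update_of_ne (by omega : i ≠ j)]
          rcases Nat.lt_succ_iff_lt_or_eq.1 hi' with hi | rfl
          · rw [Function.update_of_ne hi.ne]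
            exact h3 i i' hii hi
          · rw [Function.update_self]
            obtain ⟨c1, c2, c3, c4⟩ := h2 i hii
            exact ⟨c3.mono_right hA,
              Or.inr (Or.inl fun a ha => (card_nbrsIn_mono hA).trans (c4 a ha))⟩
      · exact absurd (hb.mono le_rfl hW' le_rfl le_rfl) hc2
      · exact absurd (b4.mono le_rfl hW' le_rfl le_rfl) (hc3 k b1 b2 b3)
  obtain ⟨B, W', -, -, h2, h3⟩ := main J le_rfl
  refine hc1 ⟨Fin J, inferInstance, fun i => B i, by simp, fun i => (h2 i i.2).1,
    fun i => (h2 i i.2).2.1, fun i j hij => ?_⟩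
  rcases lt_or_gt_of_ne (fun h => hij (Fin.ext h) : (i : ℕ) ≠ j) with hlt | hlt
  · exact h3 i j hlt j.2
  · obtain ⟨d, r⟩ := h3 j i hlt i.2
    exact ⟨d.symm, r.symm⟩

/-- A subset minimising a weighted maximum degree: it is not much smaller than its degrees allow,
and all its large subsets have comparable maximum degree. -/
lemma exists_degree_stable_subset {V : Type} (G : SimpleGraph V) {T : Finset V} {n θ ω : ℝ}
    (hθ : 0 < θ) (hω : 0 < ω) (hT : (T.card : ℝ) ≤ n) (hωT : ω ≤ T.card)
    (hdeg : ∀ v ∈ T, ((nbrsIn G v T).card : ℝ) ≤ T.card / 2 ^ 20)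
    (hpow : (2 * ω) ^ 5 * n ≤ (T.card : ℝ) ^ 5 * θ)
    (hN : ∀ W : Finset V, ω ≤ (W.card : ℝ) → ∃ v ∈ W, θ < ((nbrsIn G v W).card : ℝ)) :
    ∃ W ⊆ T, ∃ Δ : ℝ, θ < Δ ∧ 1 ≤ Δ ∧ W.Nonempty ∧
      (∀ v ∈ W, ((nbrsIn G v W).card : ℝ) ≤ Δ) ∧
      (∀ W' ⊆ W, (W.card : ℝ) / 2 ≤ W'.card →
        ∃ u ∈ W', Δ / 64 ≤ ((nbrsIn G u W').card : ℝ)) ∧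
      2 ^ 20 * Δ * (T.card : ℝ) ^ 5 ≤ (W.card : ℝ) ^ 6 := by
  let md : Finset V → ℕ := fun W => W.sup fun v => (nbrsIn G v W).card
  have hmd : ∀ W : Finset V, ∀ v ∈ W, ((nbrsIn G v W).card : ℝ) ≤ md W := fun W v hv =>
    Nat.cast_le.2 (le_sup (f := fun v => (nbrsIn G v W).card) hv)
  have hmd' : ∀ W : Finset V, W.Nonempty → ∃ v ∈ W, (md W : ℝ) = (nbrsIn G v W).card := by
    intro W hW
    obtain ⟨v, hv, h⟩ := exists_mem_eq_sup W hW fun v => (nbrsIn G v W).card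
    exact ⟨v, hv, by exact_mod_cast h⟩
  have hmdN : ∀ W : Finset V, ω ≤ (W.card : ℝ) → θ < md W := by
    intro W hW
    obtain ⟨v, hv, h⟩ := hN W hW
    exact h.trans_le (hmd W v hv)
  let f : Finset V → ℝ := fun W => max (md W : ℝ) θ / (W.card : ℝ) ^ 6
  have ht : (0 : ℝ) < T.card := hω.trans_le hωT
  have hTne : T.Nonempty := by
    rw [← card_pos]; exact_mod_cast ht
  obtain ⟨W, hW, hmin⟩ := exists_min_image (T.powerset.filter fun W => W.Nonempty) f
    ⟨T, by simp [hTne]⟩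
  simp only [mem_filter, mem_powerset] at hW hmin
  obtain ⟨hWT, hWne⟩ := hW
  have hw : (0 : ℝ) < W.card := by exact_mod_cast hWne.card_pos
  have hWTc : (W.card : ℝ) ≤ T.card := Nat.cast_le.2 (card_le_card hWT)
  have hfT : 2 ^ 20 * max (md W : ℝ) θ * (T.card : ℝ) ^ 5 ≤ (W.card : ℝ) ^ 6 := by
    have h1 := hmin T ⟨Subset.rfl, hTne⟩
    have h2 : max (md T : ℝ) θ ≤ T.card / 2 ^ 20 := by
      rw [max_eq_left (hmdN T hωT).le]
      obtain ⟨v, hv, h⟩ := hmd' T hTne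
      rw [h]
      exact hdeg v hv
    have h3 : f T ≤ 1 / (2 ^ 20 * (T.card : ℝ) ^ 5) := by
      calc f T ≤ T.card / 2 ^ 20 / (T.card : ℝ) ^ 6 := by simp only [f]; gcongr
        _ = _ := by field_simp
    have h4 := h1.trans h3
    simp only [f] at h4
    rw [div_le_div_iff₀ (by positivity) (by positivity)] at h4
    linarith
  have h2ω : 2 * ω ≤ W.card := by
    have h1 : (2 * ω) ^ 5 * n ≤ (W.card : ℝ) ^ 5 * n := by
      calc (2 * ω) ^ 5 * n ≤ (T.card : ℝ) ^ 5 * θ := hpow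
        _ ≤ (T.card : ℝ) ^ 5 * max (md W : ℝ) θ := by gcongr; exact le_max_right _ _
        _ ≤ 2 ^ 20 * max (md W : ℝ) θ * (T.card : ℝ) ^ 5 := by
          have : 0 ≤ (T.card : ℝ) ^ 5 * max (md W : ℝ) θ :=
            mul_nonneg (by positivity) (hθ.le.trans (le_max_right _ _))
          linarith
        _ ≤ (W.card : ℝ) ^ 6 := hfT
        _ = (W.card : ℝ) ^ 5 * W.card := by ring
        _ ≤ _ := by gcongr; exact hWTc.trans hT
    have h2 := le_of_mul_le_mul_right h1 (ht.trans_le hT)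
    exact le_of_pow_le_pow_left₀ (by norm_num) hw.le h2
  have hΔ := hmdN W (by linarith)
  rw [max_eq_left hΔ.le] at hfT
  refine ⟨W, hWT, md W, hΔ, ?_, hWne, hmd W, ?_, hfT⟩
  · have : (0 : ℝ) < md W := hθ.trans hΔ
    exact_mod_cast (by exact_mod_cast this : 0 < md W)
  · intro W' hW' hW'c
    have hW'0 : (0 : ℝ) < W'.card := by linarith
    have hW'ne : W'.Nonempty := by
      rw [← card_pos]; exact_mod_cast hW'0
    obtain ⟨v, hv, h⟩ := hmd' W' hW'ne
    refine ⟨v, hv, ?_⟩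
    rw [← h]
    have h1 := hmin W' ⟨hW'.trans hWT, hW'ne⟩
    simp only [f] at h1
    rw [max_eq_left hΔ.le, max_eq_left (hmdN W' (by linarith)).le,
      div_le_div_iff₀ (by positivity) (by positivity)] at h1
    have h2 : ((W.card : ℝ) / 2) ^ 6 ≤ (W'.card : ℝ) ^ 6 := by gcongr
    have h3 : (md W : ℝ) / 64 * (W.card : ℝ) ^ 6 ≤ md W' * (W.card : ℝ) ^ 6 := by
      calc _ = (md W : ℝ) * ((W.card : ℝ) / 2) ^ 6 := by ring
        _ ≤ md W * (W'.card : ℝ) ^ 6 := by gcongr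
        _ ≤ _ := h1
    exact le_of_mul_le_mul_right h3 (by positivity)

lemma hasBl_of_sparse {V : Type} {G : SimpleGraph V} (hG : Free P5ᶜ G) {T : Finset V}
    {n θ θ' ω : ℝ} {K : ℕ} (hK : 2 ≤ K) (hθ : 0 < θ) (hθ' : 0 < θ') (hω : 0 < ω)
    (hT : (T.card : ℝ) ≤ n) (hωT : ω ≤ T.card)
    (hdeg : ∀ v ∈ T, ((nbrsIn G v T).card : ℝ) ≤ T.card / 2 ^ 20)
    (hpow : (2 * ω) ^ 5 * n ≤ (T.card : ℝ) ^ 5 * θ)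
    (hN : ∀ W : Finset V, ω ≤ (W.card : ℝ) → ∃ v ∈ W, θ < ((nbrsIn G v W).card : ℝ)) :
    HasBl G 0 T K (θ' * θ / (2 ^ 12 * n * K)) ∨ HasBl G θ' T K (θ / 128) ∨
    ∃ k : ℕ, 2 ≤ k ∧ k ≤ K ∧ HasBl G θ' T k (T.card / k ^ 45) := by
  obtain ⟨W, hWT, Δ, hΔθ, hΔ1, hWne, hdegW, hlarge, hpow6⟩ :=
    exists_degree_stable_subset G hθ hω hT hωT hdeg hpow hN
  have hw : (0 : ℝ) < W.card := by exact_mod_cast hWne.card_pos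
  have hWTc : (W.card : ℝ) ≤ T.card := Nat.cast_le.2 (card_le_card hWT)
  have ht : (0 : ℝ) < T.card := hω.trans_le hωT
  have hK0 : (0 : ℝ) < K := by exact_mod_cast (by omega : 0 < K)
  have hn0 : 0 < n := ht.trans_le hT
  set w : ℝ := (W.card : ℝ)
  set t : ℝ := (T.card : ℝ)
  have hΔ0 : 0 < Δ := by linarith
  obtain ⟨h, hh, hhΔ⟩ : ∃ h : ℝ, 0 < h ∧ h ^ 2 * w = Δ :=
    ⟨√(Δ / w), Real.sqrt_pos.2 (by positivity), by
      rw [Real.sq_sqrt (by positivity)]; field_simp⟩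
  have hwt : 2 ^ 20 * h ^ 2 * t ^ 5 ≤ w ^ 5 := by
    have : (2 ^ 20 * h ^ 2 * t ^ 5) * w ≤ w ^ 5 * w := by
      calc _ = 2 ^ 20 * Δ * t ^ 5 := by rw [← hhΔ]; ring
        _ ≤ w ^ 6 := hpow6
        _ = _ := by ring
    exact le_of_mul_le_mul_right this hw
  have hh1 : h ≤ 1 / 2 ^ 10 := by
    have h1 : w ^ 5 ≤ t ^ 5 := by gcongr
    have h2 : (2 ^ 20 * h ^ 2) * t ^ 5 ≤ 1 * t ^ 5 := by linarith
    have h3 := le_of_mul_le_mul_right h2 (by positivity)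
    have h4 : h ^ 2 ≤ (1 / 2 ^ 10) ^ 2 := by linarith
    exact le_of_pow_le_pow_left₀ (by norm_num) (by norm_num) h4
  have hΔh : Δ / h = h * w := by
    rw [← hhΔ]; field_simp
  have wk : ∀ k : ℕ, 1 ≤ k → 1 ≤ 1024 * h * k → t / k ≤ w := by
    intro k hk hhk
    have hk1 : (1 : ℝ) ≤ k := by exact_mod_cast hk
    have h1 : (t / k) ^ 5 ≤ w ^ 5 := by
      calc (t / k) ^ 5 = t ^ 5 / k ^ 5 := by ring
        _ ≤ t ^ 5 / k ^ 2 := by gcongr; norm_num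
        _ ≤ 2 ^ 20 * h ^ 2 * t ^ 5 := by
          rw [div_le_iff₀ (by positivity)]
          have : 1 ^ 2 ≤ (1024 * h * k) ^ 2 := by gcongr
          calc t ^ 5 = 1 ^ 2 * t ^ 5 := by ring
            _ ≤ (1024 * h * k) ^ 2 * t ^ 5 := by gcongr
            _ = _ := by ring
        _ ≤ _ := hwt
    exact le_of_pow_le_pow_left₀ (by norm_num) hw.le h1
  set J := ⌊1 / (6 * h)⌋₊
  have hJle : (J : ℝ) ≤ 1 / (6 * h) := Nat.floor_le (by positivity)
  have hJlt : 1 / (6 * h) < J + 1 := Nat.lt_floor_add_one _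
  have hbig : 100 ≤ 1 / (6 * h) := by
    rw [le_div_iff₀ (by positivity)]
    linarith
  have hJ2 : 2 ≤ J := Nat.le_floor (by push_cast; linarith)
  have hJ2' : (2 : ℝ) ≤ J := by exact_mod_cast hJ2
  have hJh : 1 ≤ 12 * h * J := by
    have : 1 / (6 * h) ≤ 2 * J := by linarith
    rw [div_le_iff₀ (by positivity)] at this
    linarith
  rcases cuts_or_hasBl hG hK hθ' (hWTc.trans hT) hΔ1 hh hh1 hdegW hlarge (J := J) (by
      rw [le_div_iff₀ (by positivity)] at hJle
      rw [hΔh]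
      calc 6 * (h * w) * J = (J * (6 * h)) * w := by ring
        _ ≤ 1 * w := by gcongr
        _ = w := one_mul w) with hb | hb | ⟨k, b1, b2, b3, b4⟩
  · by_cases hJK : K ≤ J
    · refine Or.inr (Or.inl (hb.mono le_rfl hWT (by exact_mod_cast hJK) (by linarith)))
    · refine Or.inr (Or.inr ⟨J, hJ2, by omega, hb.mono le_rfl hWT le_rfl ?_⟩)
      have hwJ := wk J (by omega) (by nlinarith)
      calc t / J ^ 45 = t / (J ^ 42 * J ^ 3) := by rw [← pow_add]
        _ ≤ t / (2 ^ 42 * J ^ 3) := by gcongr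
        _ ≤ (1 / (12 * J)) ^ 2 * (t / J) / 128 := by
          rw [div_le_iff₀ (by positivity)]
          have : (1 / (12 * (J : ℝ))) ^ 2 * (t / J) / 128 * (2 ^ 42 * J ^ 3) =
            2 ^ 42 / (144 * 128) * t := by field_simp; norm_num
          rw [this]
          norm_num
          linarith
        _ ≤ h ^ 2 * w / 128 := by
          have : 1 / (12 * (J : ℝ)) ≤ h := by
            rw [div_le_iff₀ (by positivity)]; linarith
          gcongr
        _ = _ := by rw [← hhΔ]
  · refine Or.inl (hb.mono le_rfl hWT le_rfl ?_)
    gcongr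
  · refine Or.inr (Or.inr ⟨k, b1, b2.le, b4.mono hθ'.le hWT le_rfl ?_⟩)
    have hk : (2 : ℝ) ≤ k := by exact_mod_cast b1
    have hwk := wk k (by omega) b3
    calc t / k ^ 45 = t / (k ^ 40 * k ^ 5) := by rw [← pow_add]
      _ ≤ t / (2 ^ 40 * k ^ 5) := by gcongr
      _ = (1 / (1024 * k)) * (t / k) / (2 ^ 30 * k ^ 3) := by field_simp; norm_num
      _ ≤ h * w / (2 ^ 30 * k ^ 3) := by
        have : 1 / (1024 * (k : ℝ)) ≤ h := by
          rw [div_le_iff₀ (by positivity)]; linarith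
        gcongr
      _ = _ := by rw [← hhΔ]; field_simp

lemma hasBl_of_large {V : Type} {G : SimpleGraph V} (hG : Free P5ᶜ G) {S U : Finset V}
    (hSU : S ⊆ U) {n θ θ' ω wp : ℝ} {K : ℕ} (hK : 2 ≤ K) (hθ : 0 < θ) (hθ' : 0 < θ') (hω : 0 < ω)
    (hS : (S.card : ℝ) ≤ n) (hωS : 2 ^ 22 * ω ≤ S.card)
    (hpow : (2 * ω) ^ 5 * n ≤ ((S.card : ℝ) / 2 ^ 22) ^ 5 * θ)
    (hwp : wp ≤ θ' * S.card / (2 ^ 71 * n * K)) (hwp' : wp ≤ θ' * θ / (2 ^ 12 * n * K))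
    (hN : ∀ W : Finset V, ω ≤ (W.card : ℝ) → ∃ v ∈ W, θ < ((nbrsIn G v W).card : ℝ))
    (hN' : ¬ HasBl G 0 U K wp) (hN'' : ¬ HasBl G θ' U K (θ / 128)) :
    ∃ k : ℕ, 2 ≤ k ∧ k ≤ K ∧ HasBl G θ' S k (S.card / k ^ 90) := by
  have hs : (0 : ℝ) < S.card := lt_of_lt_of_le (by positivity) hωS
  have hSne : S.Nonempty := by
    rw [← card_pos]; exact_mod_cast hs
  rcases sparse_subset_or_hasBl hG hK hθ' hSne hS with h | h | ⟨T, hTS, hTc, hdeg⟩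
  · exact absurd (h.mono le_rfl hSU le_rfl hwp) hN'
  · exact h
  · have hT : (T.card : ℝ) ≤ n := le_trans (Nat.cast_le.2 (card_le_card hTS)) hS
    rcases hasBl_of_sparse hG hK hθ hθ' hω hT (by linarith) hdeg
      (hpow.trans (by gcongr)) hN with h | h | ⟨k, h1, h2, h3⟩
    · exact absurd (h.mono le_rfl (hTS.trans hSU) le_rfl hwp') hN'
    · exact absurd (h.mono le_rfl (hTS.trans hSU) le_rfl le_rfl) hN''
    · refine ⟨k, h1, h2, h3.mono le_rfl hTS le_rfl ?_⟩
      have hk : (2 : ℝ) ≤ k := by exact_mod_cast h1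
      have hk45 : (2 : ℝ) ^ 22 ≤ (k : ℝ) ^ 45 :=
        (pow_le_pow_right₀ (by norm_num) (by norm_num)).trans
          (pow_le_pow_left₀ (by norm_num) hk 45)
      calc (S.card : ℝ) / (k : ℝ) ^ 90 = S.card / ((k : ℝ) ^ 45 * (k : ℝ) ^ 45) := by
            rw [← pow_add]
        _ ≤ S.card / (2 ^ 22 * (k : ℝ) ^ 45) := by gcongr
        _ = S.card / 2 ^ 22 / (k : ℝ) ^ 45 := by rw [div_div]
        _ ≤ (T.card : ℝ) / (k : ℝ) ^ 45 := by gcongr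

lemma HasBl.refine {V : Type} {G : SimpleGraph V} {θ w w' y y' : ℝ} {S : Finset V}
    (h : HasBl G θ S y w) (hy' : 0 ≤ y')
    (hB : ∀ B ⊆ S, w ≤ (B.card : ℝ) → HasBl G θ B y' w') : HasBl G θ S (y * y') w' := by
  obtain ⟨ι, _, B, h1, h2, h3, h4⟩ := h
  choose κ _ C c1 c2 c3 c4 using fun i => hB (B i) (h2 i) (h3 i)
  refine ⟨Σ i, κ i, inferInstance, fun p => C p.1 p.2, ?_, fun p => (c2 p.1 p.2).trans (h2 p.1),
    fun p => c3 p.1 p.2, ?_⟩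
  · rw [Fintype.card_sigma]
    push_cast
    calc y * y' ≤ (Fintype.card ι : ℝ) * y' := by gcongr
      _ = ∑ i : ι, y' := by simp
      _ ≤ _ := sum_le_sum fun i _ => c1 i
  · rintro ⟨i, p⟩ ⟨j, q⟩ hpq
    by_cases hij : i = j
    · subst hij
      exact c4 i p q fun h => hpq (by rw [h])
    · obtain ⟨d, r⟩ := h4 i j hij
      exact ⟨d.mono (c2 i p) (c2 j q), r.mono (c2 i p) (c2 j q)⟩

lemma hasBl_of_forall_exists {V : Type} {G : SimpleGraph V} {θ w : ℝ} {K : ℕ} (hK : 2 ≤ K)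
    (hw : 0 < w)
    (hstep : ∀ S : Finset V, w ≤ (S.card : ℝ) →
      ∃ k : ℕ, 2 ≤ k ∧ k ≤ K ∧ HasBl G θ S k (S.card / k ^ 90))
    (M : ℕ) {S : Finset V} {y : ℝ} (hy : 1 ≤ y) (hyM : y ≤ 2 ^ M)
    (hS : y ^ 90 * w ≤ S.card) : HasBl G θ S y (w / K ^ 90) := by
  have hK0 : (0 : ℝ) < K := by exact_mod_cast (by omega : 0 < K)
  induction M generalizing S y with
  | zero =>
    have hwS : w ≤ S.card := le_trans (le_mul_of_one_le_left hw.le (one_le_pow₀ hy)) hS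
    obtain ⟨k, h1, h2, h3⟩ := hstep S hwS
    have hk : (2 : ℝ) ≤ k := by exact_mod_cast h1
    refine h3.mono le_rfl Subset.rfl (by linarith) ?_
    gcongr
  | succ M ih =>
    have hwS : w ≤ S.card := le_trans (le_mul_of_one_le_left hw.le (one_le_pow₀ hy)) hS
    obtain ⟨k, h1, h2, h3⟩ := hstep S hwS
    have hk : (2 : ℝ) ≤ k := by exact_mod_cast h1
    by_cases hyk : y ≤ k
    · refine h3.mono le_rfl Subset.rfl hyk ?_
      gcongr
    · push Not at hyk
      have h4 : HasBl G θ S (k * (y / k)) (w / K ^ 90) := by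
        refine h3.refine (by positivity) fun B _ hB => ih ?_ ?_ (le_trans ?_ hB)
        · rw [le_div_iff₀ (by positivity)]; linarith
        · rw [div_le_iff₀ (by positivity)]
          rw [pow_succ] at hyM
          have : (2 : ℝ) ^ M * 2 ≤ 2 ^ M * k := by gcongr
          linarith
        · rw [div_pow, div_mul_eq_mul_div]
          gcongr
      rwa [mul_div_cancel₀ _ (by positivity)] at h4

lemma exists_disjoint_subsets {V : Type} (q k : ℕ) (W : Finset V) (hW : k * q ≤ W.card) :
    ∃ B : Fin k → Finset V, (∀ i, B i ⊆ W) ∧ (∀ i, (B i).card = q) ∧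
      ∀ i j, i ≠ j → Disjoint (B i) (B j) := by
  induction k generalizing W with
  | zero => exact ⟨fun i => i.elim0, fun i => i.elim0, fun i => i.elim0, fun i => i.elim0⟩
  | succ k ih =>
    rw [add_mul, one_mul] at hW
    obtain ⟨C, hC, hCc⟩ := exists_subset_card_eq (by omega : q ≤ W.card)
    obtain ⟨B, h1, h2, h3⟩ := ih (W \ C) (by rw [card_sdiff_of_subset hC]; omega)
    have dj : ∀ i, Disjoint C (B i) := fun i =>
      (disjoint_sdiff (s := C) (t := W)).mono_right (h1 i)
    refine ⟨Fin.cons C B, fun i => ?_, fun i => ?_, fun i j => ?_⟩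
    · exact Fin.cases hC (fun i => (h1 i).trans sdiff_subset) i
    · exact Fin.cases hCc h2 i
    · refine Fin.cases ?_ (fun i => ?_) i <;> refine Fin.cases ?_ (fun j => ?_) j
      · exact fun h => absurd rfl h
      · exact fun _ => dj j
      · exact fun _ => (dj i).symm
      · exact fun h => h3 i j fun h' => h (by rw [h'])

lemma hasBl_of_low_degree {V : Type} {G : SimpleGraph V} {W : Finset V} {θ ω : ℝ} {K : ℕ}
    (hK : 0 < K) (hω : K ≤ ω) (hW : ω ≤ W.card)
    (hdeg : ∀ v ∈ W, ((nbrsIn G v W).card : ℝ) ≤ θ) : HasBl G θ W K (ω / (2 * K)) := by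
  have hK0 : (0 : ℝ) < K := by exact_mod_cast hK
  obtain ⟨B, h1, h2, h3⟩ := exists_disjoint_subsets (W.card / K) K W (Nat.mul_div_le _ _)
  refine ⟨Fin K, inferInstance, B, by simp, h1, fun i => ?_, fun i j hij => ⟨h3 i j hij,
    Or.inr (Or.inl fun p hp => (card_nbrsIn_mono (h1 j)).trans (hdeg p (h1 i hp)))⟩⟩
  rw [h2]
  have hq1 : 1 ≤ W.card / K := by
    rw [Nat.one_le_div_iff hK]
    exact_mod_cast hω.trans hW
  have hq2 : W.card < (W.card / K + 1) * K := Nat.lt_mul_of_div_lt (Nat.lt_succ_self _) hK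
  have hq1' : (1 : ℝ) ≤ ((W.card / K : ℕ) : ℝ) := by exact_mod_cast hq1
  have hq2' : (W.card : ℝ) < (((W.card / K : ℕ) : ℝ) + 1) * K := by exact_mod_cast hq2
  rw [div_le_iff₀ (by positivity)]
  nlinarith

lemma exists_hasBl {V : Type} [Fintype V] {G : SimpleGraph V} (hG : Free P5ᶜ G) {x : ℝ} {N : ℕ}
    (hx0 : 0 < x) (hx : x < 1 / 2) (hN : 5000 ≤ N) (hn : 1 ≤ x ^ N * Fintype.card V) :
    ∃ θ w : ℝ, HasBl G θ univ x⁻¹ w ∧ θ ≤ x ^ 1000 * w ∧ x ^ N * Fintype.card V ≤ w := by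
  obtain ⟨n, hn_def⟩ : ∃ n : ℝ, n = Fintype.card V := ⟨_, rfl⟩
  rw [← hn_def] at hn ⊢
  have hn0 : 0 < n := by
    by_contra h
    push Not at h
    have : 0 < x ^ N := by positivity
    nlinarith
  have hle : ∀ {a b : ℕ}, a ≤ b → x ^ b * n ≤ x ^ a * n := fun h =>
    mul_le_mul_of_nonneg_right (pow_le_pow_of_le_one hx0.le (by linarith) h) hn0.le
  have h2x : ∀ k : ℕ, x ^ k * 2 ^ k ≤ 1 := fun k => by
    rw [← mul_pow]
    exact pow_le_one₀ (by positivity) (by linarith)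
  set K := ⌈x⁻¹⌉₊
  have hxK : x⁻¹ ≤ K := Nat.le_ceil _
  have hx2 : 2 < x⁻¹ := by
    rw [lt_inv_comm₀ (by norm_num) hx0]; linarith
  have hK2' : (2 : ℝ) < K := hx2.trans_le hxK
  have hK2 : 2 ≤ K := by
    have : 2 < K := by exact_mod_cast hK2'
    omega
  have hK0 : (0 : ℝ) < K := by linarith
  have hKx : x ^ 2 * K ≤ 1 := by
    have h1 : (K : ℝ) ≤ 2 * x⁻¹ := by
      have := Nat.ceil_lt_add_one (by positivity : 0 ≤ x⁻¹)
      linarith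
    calc x ^ 2 * K ≤ x ^ 2 * (2 * x⁻¹) := by gcongr
      _ = 2 * x := by field_simp
      _ ≤ 1 := by linarith
  have hKx' : ∀ k : ℕ, x ^ (2 * k) * (K : ℝ) ^ k ≤ 1 := fun k => by
    rw [pow_mul, ← mul_pow]
    exact pow_le_one₀ (by positivity) hKx
  have hcard : ∀ S : Finset V, (S.card : ℝ) ≤ n := fun S => by
    rw [hn_def]; exact Nat.cast_le.2 (card_le_univ S)
  by_contra hcon
  push Not at hcon
  have goal : ∀ θ w : ℝ, θ ≤ x ^ 1000 * w → x ^ N * n ≤ w → ¬ HasBl G θ univ K w :=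
    fun θ w h1 h2 h => absurd h2
      (not_le.2 (hcon θ w (h.mono le_rfl Subset.rfl hxK le_rfl) h1))
  have hN1 : ∀ W : Finset V, x ^ 507 * n ≤ (W.card : ℝ) →
      ∃ v ∈ W, x ^ 1520 * n < ((nbrsIn G v W).card : ℝ) := by
    intro W hW
    by_contra h
    push Not at h
    have hw : x ^ 510 * n ≤ x ^ 507 * n / (2 * K) := by
      rw [le_div_iff₀ (by positivity)]
      have : x ^ 510 * n * (2 * K) = (x ^ 507 * n) * ((x ^ 1 * 2 ^ 1) * (x ^ 2 * K)) := by ring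
      rw [this]
      exact mul_le_of_le_one_right (by positivity) (mul_le_one₀ (h2x 1) (by positivity) hKx)
    refine goal (x ^ 1520 * n) _ ?_ ((hle (by omega)).trans hw)
      ((hasBl_of_low_degree (by omega) ?_ hW h).mono le_rfl (subset_univ _) le_rfl le_rfl)
    · calc x ^ 1520 * n ≤ x ^ 1510 * n := hle (by norm_num)
        _ = x ^ 1000 * (x ^ 510 * n) := by ring
        _ ≤ _ := by gcongr
    · have h1 : 1 ≤ x ^ 509 * n := hn.trans (hle (by omega))
      have h2 : x ^ 2 * K ≤ x ^ 2 * (x ^ 507 * n) := by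
        calc x ^ 2 * K ≤ 1 := hKx
          _ ≤ x ^ 509 * n := h1
          _ = _ := by ring
      exact le_of_mul_le_mul_left h2 (by positivity)
  have hcardK : n / (K : ℝ) ^ 90 ≥ x ^ 180 * n := by
    rw [ge_iff_le, le_div_iff₀ (by positivity)]
    calc x ^ 180 * n * (K : ℝ) ^ 90 = n * (x ^ (2 * 90) * (K : ℝ) ^ 90) := by ring
      _ ≤ n := mul_le_of_le_one_right hn0.le (hKx' 90)
  have hstep : ∀ S : Finset V, n / (K : ℝ) ^ 90 ≤ (S.card : ℝ) →
      ∃ k : ℕ, 2 ≤ k ∧ k ≤ K ∧ HasBl G (x ^ 2530 * n) S k ((S.card : ℝ) / (k : ℝ) ^ 90) := by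
    intro S hS
    have hS1 : x ^ 180 * n ≤ (S.card : ℝ) := hcardK.trans hS
    have hS2 : x ^ 202 * n ≤ (S.card : ℝ) / 2 ^ 22 := by
      rw [le_div_iff₀ (by positivity)]
      calc x ^ 202 * n * 2 ^ 22 = (x ^ 180 * n) * (x ^ 22 * 2 ^ 22) := by ring
        _ ≤ x ^ 180 * n := mul_le_of_le_one_right (by positivity) (h2x 22)
        _ ≤ _ := hS1
    refine hasBl_of_large (θ := x ^ 1520 * n) (ω := x ^ 507 * n) (wp := x ^ 4100 * n) hG
      (subset_univ S) hK2 (by positivity) (by positivity) (by positivity) (hcard S) ?_ ?_ ?_ ?_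
      hN1 (goal _ _ (by positivity) (hle (by omega))) (goal _ _ ?_ ?_)
    · rw [le_div_iff₀ (by positivity)] at hS2
      calc 2 ^ 22 * (x ^ 507 * n) ≤ 2 ^ 22 * (x ^ 202 * n) := by
            have := hle (show 202 ≤ 507 by norm_num)
            gcongr
        _ = x ^ 202 * n * 2 ^ 22 := by ring
        _ ≤ _ := hS2
    · calc (2 * (x ^ 507 * n)) ^ 5 * n = (x ^ 5 * 2 ^ 5) * (x ^ 2530 * n ^ 6) := by ring
        _ ≤ x ^ 2530 * n ^ 6 := mul_le_of_le_one_left (by positivity) (h2x 5)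
        _ = (x ^ 202 * n) ^ 5 * (x ^ 1520 * n) := by ring
        _ ≤ _ := by gcongr
    · rw [le_div_iff₀ (by positivity)]
      calc x ^ 4100 * n * (2 ^ 71 * n * K)
          = (x ^ 71 * 2 ^ 71) * (x ^ 2 * K) * (x ^ 4027 * n * n) := by ring
        _ ≤ 1 * 1 * (x ^ 4027 * n * n) := by
            have := h2x 71
            gcongr
        _ = x ^ 4027 * n * n := by ring
        _ ≤ x ^ 2710 * n * n := by
            have := hle (show 2710 ≤ 4027 by norm_num)
            gcongr
        _ = (x ^ 2530 * n) * (x ^ 180 * n) := by ring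
        _ ≤ _ := by gcongr
    · rw [le_div_iff₀ (by positivity)]
      calc x ^ 4100 * n * (2 ^ 12 * n * K)
          = (x ^ 12 * 2 ^ 12) * (x ^ 2 * K) * (x ^ 4086 * n * n) := by ring
        _ ≤ 1 * 1 * (x ^ 4086 * n * n) := by
            have := h2x 12
            gcongr
        _ = x ^ 4086 * n * n := by ring
        _ ≤ x ^ 4050 * n * n := by
            have := hle (show 4050 ≤ 4086 by norm_num)
            gcongr
        _ = _ := by ring
    · rw [mul_div_assoc', le_div_iff₀ (by norm_num)]
      calc x ^ 2530 * n * 128 = (x ^ 7 * 2 ^ 7) * (x ^ 2523 * n) := by ring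
        _ ≤ x ^ 2523 * n := mul_le_of_le_one_left (by positivity) (h2x 7)
        _ ≤ x ^ 2520 * n := hle (by norm_num)
        _ = _ := by ring
    · rw [le_div_iff₀ (by norm_num)]
      calc x ^ N * n * 128 ≤ x ^ 1527 * n * 128 := by
            have := hle (show 1527 ≤ N by omega)
            gcongr
        _ = (x ^ 7 * 2 ^ 7) * (x ^ 1520 * n) := by ring
        _ ≤ x ^ 1520 * n := mul_le_of_le_one_left (by positivity) (h2x 7)
  have hfin : HasBl G (x ^ 2530 * n) univ K (n / (K : ℝ) ^ 90 / (K : ℝ) ^ 90) :=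
    hasBl_of_forall_exists (M := K) hK2 (by positivity) hstep (by linarith)
      (by exact_mod_cast Nat.lt_two_pow_self.le)
      (by rw [mul_div_cancel₀ _ (by positivity), card_univ, hn_def])
  have hw : x ^ 360 * n ≤ n / (K : ℝ) ^ 90 / (K : ℝ) ^ 90 := by
    rw [div_div, le_div_iff₀ (by positivity)]
    calc x ^ 360 * n * ((K : ℝ) ^ 90 * (K : ℝ) ^ 90) = n * (x ^ (2 * 180) * (K : ℝ) ^ 180) := by
          ring
      _ ≤ n := mul_le_of_le_one_right hn0.le (hKx' 180)
  refine goal _ _ ?_ ((hle (by omega)).trans hw) hfin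
  calc x ^ 2530 * n ≤ x ^ 1360 * n := hle (by norm_num)
    _ = x ^ 1000 * (x ^ 360 * n) := by ring
    _ ≤ _ := by gcongr

lemma edgesBetween_eq_sum_left {V : Type} (G : SimpleGraph V) (P Q : Finset V) :
    edgesBetween G P Q = ∑ p ∈ P, (nbrsIn G p Q).card := by
  unfold edgesBetween nbrsIn
  rw [card_filter, sum_product]
  exact sum_congr rfl fun p _ => (card_filter _ _).symm

lemma edgesBetween_comm {V : Type} (G : SimpleGraph V) (P Q : Finset V) :
    edgesBetween G P Q = edgesBetween G Q P := by
  unfold edgesBetween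
  rw [card_filter, card_filter, sum_product, sum_product_right]
  simp only [G.adj_comm]

lemma edgesBetween_le_of_forall {V : Type} {G : SimpleGraph V} {P Q : Finset V} {x θ w : ℝ}
    (hx : 0 ≤ x) (hθ : θ ≤ x * w) (hw : w ≤ Q.card)
    (h : ∀ p ∈ P, ((nbrsIn G p Q).card : ℝ) ≤ θ) :
    (edgesBetween G P Q : ℝ) ≤ x * P.card * Q.card := by
  rw [edgesBetween_eq_sum_left]
  push_cast
  calc ∑ p ∈ P, ((nbrsIn G p Q).card : ℝ) ≤ ∑ _p ∈ P, x * (Q.card : ℝ) :=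
        sum_le_sum fun p hp => (h p hp).trans (hθ.trans (by gcongr))
    _ = x * P.card * Q.card := by
        rw [sum_const, nsmul_eq_mul]
        ring

lemma BlockRel.completePair_or_weaklySparse {V : Type} {G : SimpleGraph V} {P Q : Finset V}
    {x θ w : ℝ} (h : BlockRel G θ P Q) (hx : 0 ≤ x) (hθ : θ ≤ x * w) (hP : w ≤ P.card)
    (hQ : w ≤ Q.card) : CompletePair G P Q ∨ WeaklySparse G x P Q := by
  rcases h with h | h | h
  · exact Or.inl h
  · exact Or.inr (edgesBetween_le_of_forall hx hθ hQ h)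
  · right
    unfold WeaklySparse
    rw [edgesBetween_comm, mul_right_comm]
    exact edgesBetween_le_of_forall hx hθ hP h

/-- the key blockade lemma for house-free graphs. -/
theorem house_free_blockade :
    ∃ d : ℝ, 40 ≤ d ∧
      ∀ ε : ℝ, 0 < ε → ε < 1/2 →
        ∀ (V : Type) [Fintype V] (G : SimpleGraph V),
          Free P5ᶜ G → ε ^ (-(10 * d ^ 2)) ≤ (Fintype.card V : ℝ) →
          ∃ (n : ℕ) (B : Fin n → Finset V), IsBlockade B ∧
            ε⁻¹ ≤ (n : ℝ) ∧
            (∀ i, ε ^ (10 * d ^ 2) * (Fintype.card V : ℝ) ≤ ((B i).card : ℝ)) ∧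
            (∀ i j, i ≠ j →
              CompletePair G (B i) (B j) ∨ WeaklySparse G (ε ^ d) (B i) (B j)) := by
  refine ⟨1000, by norm_num, fun ε hε0 hε V _ G hG hcard => ?_⟩
  have hd : (10 * 1000 ^ 2 : ℝ) = ((10000000 : ℕ) : ℝ) := by norm_num
  have hd' : (1000 : ℝ) = ((1000 : ℕ) : ℝ) := by norm_num
  rw [hd, Real.rpow_neg hε0.le, Real.rpow_natCast] at hcard
  simp only [hd, Real.rpow_natCast]
  rw [hd', Real.rpow_natCast]
  obtain ⟨N, hN⟩ : ∃ N : ℕ, N = 10000000 := ⟨_, rfl⟩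
  rw [← hN] at hcard ⊢
  have hn : 1 ≤ ε ^ N * (Fintype.card V : ℝ) := by
    have hpos : 0 < ε ^ N := pow_pos hε0 N
    rwa [inv_le_iff_one_le_mul₀ hpos, mul_comm] at hcard
  obtain ⟨θ, w, ⟨ι, _, B, h1, -, h3, h4⟩, hθ, hw⟩ :=
    exists_hasBl hG hε0 hε (by omega : 5000 ≤ N) hn
  have e := (Fintype.equivFin ι).symm
  have he : ∀ i j, i ≠ j → e i ≠ e j := fun i j h h' => h (e.injective h')
  exact ⟨Fintype.card ι, fun i => B (e i), fun i j hij => (h4 _ _ (he i j hij)).1, h1,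
    fun i => hw.trans (h3 _), fun i j hij => (h4 _ _ (he i j hij)).2.completePair_or_weaklySparse
      (pow_nonneg hε0.le _) hθ (h3 _) (h3 _)⟩
end

section
/- Let k ≥ 2 be an integer, and let G be a graph every one of whose anticonnected components has fewer than |G|/k vertices. Then there is a complete (k, |G|/k²)-blockade in G. -/
open Finset
open scoped Classical

/-- A finset of total weight at least `w` with all weights at most `M`, where `2 * w ≤ M`,
has a subset of total weight between `w` and `M`. -/
theorem exists_subset_sum_between {ι : Type*} {f : ι → ℝ} {w M : ℝ} (hf : ∀ i, 0 ≤ f i)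
    (hfM : ∀ i, f i ≤ M) (hM : 0 ≤ M) (hwM : 2 * w ≤ M) {S : Finset ι} (hS : w ≤ ∑ i ∈ S, f i) :
    ∃ T ⊆ S, w ≤ ∑ i ∈ T, f i ∧ ∑ i ∈ T, f i ≤ M := by
  induction S using Finset.strongInduction with
  | H S ih =>
    by_cases hlight : ∑ i ∈ S, f i ≤ M
    · exact ⟨S, Subset.rfl, hS, hlight⟩
    by_cases hred : ∃ a ∈ S, w ≤ ∑ i ∈ S.erase a, f i
    · obtain ⟨a, ha, hwa⟩ := hred
      obtain ⟨T, hTS, hT⟩ := ih _ (erase_ssubset ha) hwa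
      exact ⟨T, hTS.trans (erase_subset a S), hT⟩
    · exfalso
      push Not at hred hlight
      obtain ⟨a, ha⟩ : S.Nonempty := by
        rw [nonempty_iff_ne_empty]
        rintro rfl
        simp only [sum_empty] at hlight
        linarith
      have hsum := add_sum_erase S f ha
      obtain ⟨b, hb⟩ : (S.erase a).Nonempty := by
        rw [nonempty_iff_ne_empty]
        intro hempty
        rw [hempty, sum_empty] at hsum
        linarith [hfM a]
      have hab : a ∈ S.erase b := mem_erase.2 ⟨(ne_of_mem_erase hb).symm, ha⟩
      have hle := single_le_sum (f := f) (fun i _ => hf i) hab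
      linarith [hred a ha, hred b (mem_of_mem_erase hb)]

/-- Items of weight at most `M` and of total weight at least `k * M` can be distributed into
`k` classes of weight at least `w` each, provided `2 * w ≤ M`. -/
theorem exists_partition_sum_ge {ι : Type*} {f : ι → ℝ} {w M : ℝ} (hf : ∀ i, 0 ≤ f i)
    (hfM : ∀ i, f i ≤ M) (hM : 0 ≤ M) (hwM : 2 * w ≤ M) (k : ℕ) (S : Finset ι)
    (hS : k * M ≤ ∑ i ∈ S, f i) :
    ∃ g : ι → ℕ, ∀ j < k, w ≤ ∑ i ∈ S with g i = j, f i := by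
  induction k generalizing S with
  | zero => exact ⟨fun _ => 0, by simp⟩
  | succ k ih =>
    push_cast at hS
    have hkM : 0 ≤ k * M := by positivity
    obtain ⟨T, hTS, hwT, hTM⟩ := exists_subset_sum_between hf hfM hM hwM
      (show w ≤ ∑ i ∈ S, f i by linarith)
    have hsum := sum_sdiff (f := f) hTS
    obtain ⟨g, hg⟩ := ih (S \ T) (by linarith)
    refine ⟨fun i => if i ∈ T then k else g i, fun j hj => ?_⟩
    rcases Nat.lt_succ_iff_lt_or_eq.1 hj with hj | rfl
    · refine (hg j hj).trans (sum_le_sum_of_subset_of_nonneg ?_ fun i _ _ => hf i)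
      intro i hi
      simp only [mem_filter, mem_sdiff] at hi ⊢
      simp [hi]
    · refine hwT.trans (sum_le_sum_of_subset_of_nonneg ?_ fun i _ _ => hf i)
      intro i hi
      simp [hi, hTS hi]

/-- graphs whose anticonnected components are all small contain a long and wide
complete blockade. -/
theorem small_anticomponents_complete_blockade
    (V : Type) [Fintype V] (G : SimpleGraph V) (k : ℕ) (hk : 2 ≤ k)
    (h : ∀ c : Gᶜ.ConnectedComponent, (c.supp.ncard : ℝ) < (Fintype.card V : ℝ) / (k : ℝ)) :
    ∃ (n : ℕ) (B : Fin n → Finset V), IsBlockade B ∧ k ≤ n ∧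
      (∀ i, (Fintype.card V : ℝ) / (k : ℝ) ^ 2 ≤ ((B i).card : ℝ)) ∧
      CompleteBlockade G B := by
  have hk0 : (0 : ℝ) < k := by positivity
  have hk2 : (2 : ℝ) ≤ k := by exact_mod_cast hk
  have hN : (0 : ℝ) ≤ Fintype.card V := by positivity
  let f : Gᶜ.ConnectedComponent → ℝ := fun c =>
    (#{v : V | Gᶜ.connectedComponentMk v = c} : ℝ)
  have hsupp (c : Gᶜ.ConnectedComponent) : f c = c.supp.ncard := by
    simp only [f]
    rw [← Set.ncard_coe_finset]
    congr 2
    ext v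
    simp
  have hcard (P : Gᶜ.ConnectedComponent → Prop) [DecidablePred P] :
      (#{v : V | P (Gᶜ.connectedComponentMk v)} : ℝ) = ∑ c with P c, f c := by
    rw [card_eq_sum_card_fiberwise (t := {c | P c}) (f := Gᶜ.connectedComponentMk)
      (fun v hv => by simpa using hv)]
    push_cast
    refine sum_congr rfl fun c hc => ?_
    simp only [f, filter_filter]
    congr 2
    ext v
    simp only [mem_filter, mem_univ, true_and] at hc ⊢
    exact ⟨fun hv => hv.2, fun hv => ⟨hv ▸ hc, hv⟩⟩
  obtain ⟨g, hg⟩ := exists_partition_sum_ge (f := f) (w := Fintype.card V / (k : ℝ) ^ 2)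
    (M := Fintype.card V / (k : ℝ)) (fun c => Nat.cast_nonneg _)
    (fun c => by rw [hsupp]; exact (h c).le) (by positivity)
    (by
      rw [mul_div_assoc', div_le_div_iff₀ (by positivity) hk0]
      nlinarith [mul_nonneg (mul_nonneg hN hk0.le) (sub_nonneg.2 hk2)])
    k univ (by
      have huniv := hcard fun _ => True
      simp only [filter_true, card_univ] at huniv
      rw [← huniv, mul_div_cancel₀ _ hk0.ne'])
  refine ⟨k, fun j => {v : V | g (Gᶜ.connectedComponentMk v) = j}, ?_, le_rfl, ?_, ?_⟩
  · intro i j hij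
    rw [disjoint_left]
    intro v hi hj
    simp only [mem_filter, mem_univ, true_and] at hi hj
    exact hij (Fin.ext (hi.symm.trans hj))
  · intro j
    exact (hg j j.2).trans_eq (hcard fun c => g c = j).symm
  · intro i j hij a ha b hb
    simp only [mem_filter, mem_univ, true_and] at ha hb
    have hmk : Gᶜ.connectedComponentMk a ≠ Gᶜ.connectedComponentMk b := fun hab =>
      hij (Fin.ext (by rw [← ha, ← hb, hab]))
    by_contra hadj
    have hne : a ≠ b := fun hab => hmk (hab ▸ rfl)
    exact hmk (SimpleGraph.ConnectedComponent.sound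
      (SimpleGraph.Adj.reachable ((SimpleGraph.compl_adj G a b).2 ⟨hne, hadj⟩)))
end

section
/- Let G be a graph and let A, B ⊆ V(G) be nonempty and disjoint, such that each vertex in A has at most Δ > 0 neighbours in B. Then either: at most 20·√(|B|·Δ) vertices in B have a neighbour in A; or, for some integer k ≥ 1, there is a (k, |B|/k²)-comb ((a_i, B_i) : i ∈ [k]) in G where a_i ∈ A and B_i ⊆ B for all i ∈ [k]. -/
open Finset
open scoped Classical

/-- The vertices of `B` with a neighbour in `S`. -/
noncomputable def covered {V : Type*} (G : SimpleGraph V) (S B : Finset V) : Finset V :=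
  B.filter (fun v => ∃ a ∈ S, G.Adj a v)

/-- The neighbours of `a` in `B` that have no other neighbour in `S`. -/
noncomputable def privateNbrs {V : Type*} (G : SimpleGraph V) (S B : Finset V) (a : V) :
    Finset V :=
  B.filter (fun v => G.Adj a v ∧ ∀ a' ∈ S, G.Adj a' v → a' = a)

/-- There is a comb with apexes in `A`, blocks in `B`, some length `k ≥ 1` and width at least
`n / k ^ 2`. -/
def HasWideComb {V : Type*} (G : SimpleGraph V) (A B : Finset V) (n : ℝ) : Prop :=
  ∃ k : ℕ, 1 ≤ k ∧ ∃ (a : Fin k → V) (Bl : Fin k → Finset V),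
    IsComb G a Bl ∧ (∀ i, a i ∈ A) ∧ (∀ i, Bl i ⊆ B) ∧
    (∀ i, n / (k : ℝ) ^ 2 ≤ ((Bl i).card : ℝ))

theorem HasWideComb.mono {V : Type*} {G : SimpleGraph V} {A B B' : Finset V} {n : ℝ}
    (h : HasWideComb G A B' n) (hB : B' ⊆ B) : HasWideComb G A B n := by
  obtain ⟨k, hk, a, Bl, hc, ha, hBl, hw⟩ := h
  exact ⟨k, hk, a, Bl, hc, ha, fun i => (hBl i).trans hB, hw⟩

theorem hasWideComb_of_privateNbrs {V : Type*} {G : SimpleGraph V} {A B S : Finset V} {n : ℝ}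
    (hAB : Disjoint A B) (hSA : S ⊆ A) (hS : S.Nonempty)
    (hw : ∀ a ∈ S, n / (S.card : ℝ) ^ 2 ≤ ((privateNbrs G S B a).card : ℝ)) :
    HasWideComb G A B n := by
  have hmem : ∀ i, (S.equivFin.symm i : V) ∈ S := fun i => (S.equivFin.symm i).2
  have hinj : Function.Injective fun i => (S.equivFin.symm i : V) :=
    Subtype.val_injective.comp S.equivFin.symm.injective
  refine ⟨S.card, hS.card_pos, fun i => (S.equivFin.symm i : V),
    fun i => privateNbrs G S B (S.equivFin.symm i : V), ⟨?_, hinj, ?_, ?_, ?_⟩,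
    fun i => hSA (hmem i), fun i => filter_subset _ _, fun i => hw _ (hmem i)⟩
  · intro i j hij
    rw [Finset.disjoint_left]
    intro v hv hv'
    simp only [privateNbrs, mem_filter] at hv hv'
    exact hij (hinj (hv'.2.2 _ (hmem i) hv.2.1))
  · intro i j hij
    exact Finset.disjoint_left.mp hAB (hSA (hmem i)) (mem_filter.mp hij).1
  · intro i v hv
    exact (mem_filter.mp hv).2.1
  · intro i j hij v hv hadj
    exact hij (hinj ((mem_filter.mp hv).2.2 _ (hmem i) hadj))

theorem card_covered_insert {V : Type*} (G : SimpleGraph V) (S B : Finset V) (a : V) :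
    (covered G (insert a S) B).card =
      (covered G S B).card + (nbrsIn G a (B \ covered G S B)).card := by
  rw [← card_union_of_disjoint]
  · congr 1
    ext v
    simp only [covered, nbrsIn, mem_filter, mem_union, mem_sdiff, mem_insert]
    grind
  · rw [Finset.disjoint_left]
    intro v hv hv'
    exact (mem_sdiff.mp (mem_filter.mp hv').1).2 hv

theorem nbrsIn_sdiff_covered_erase {V : Type*} (G : SimpleGraph V) (S B : Finset V) (a : V) :
    nbrsIn G a (B \ covered G (S.erase a) B) = privateNbrs G S B a := by
  ext v
  simp only [covered, nbrsIn, privateNbrs, mem_filter, mem_sdiff, mem_erase]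
  grind

theorem card_covered_le {V : Type*} (G : SimpleGraph V) (S B : Finset V) {Δ : ℝ}
    (h : ∀ a ∈ S, ((nbrsIn G a B).card : ℝ) ≤ Δ) :
    ((covered G S B).card : ℝ) ≤ S.card * Δ := by
  have hsub : covered G S B = S.biUnion (fun a => nbrsIn G a B) := by
    ext v
    simp only [covered, nbrsIn, mem_filter, mem_biUnion]
    grind
  rw [hsub]
  calc ((S.biUnion (fun a => nbrsIn G a B)).card : ℝ)
      ≤ ∑ a ∈ S, ((nbrsIn G a B).card : ℝ) := by exact_mod_cast card_biUnion_le
    _ ≤ S.card * Δ := by simpa using sum_le_card_nsmul S _ Δ h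

/-- A set maximising `|covered S| - c |S|`: its members have many private neighbours, and no
vertex has many uncovered neighbours. -/
theorem exists_subset_privateNbrs_ge {V : Type*} (G : SimpleGraph V) (A B : Finset V) {c : ℝ}
    (hc : 0 ≤ c) :
    ∃ S ⊆ A, (∀ a ∈ S, c ≤ ((privateNbrs G S B a).card : ℝ)) ∧
      ∀ a ∈ A, ((nbrsIn G a (B \ covered G S B)).card : ℝ) ≤ c := by
  obtain ⟨S, hS, hmax⟩ := A.powerset.exists_max_image
    (fun S => ((covered G S B).card : ℝ) - c * S.card) ⟨∅, by simp⟩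
  rw [mem_powerset] at hS
  refine ⟨S, hS, fun a ha => ?_, fun a ha => ?_⟩
  · have h1 := hmax (S.erase a) (mem_powerset.mpr ((erase_subset _ _).trans hS))
    have h2 := card_covered_insert G (S.erase a) B a
    rw [insert_erase ha, nbrsIn_sdiff_covered_erase] at h2
    have h3 : (S.card : ℝ) = (S.erase a).card + 1 := by
      exact_mod_cast (card_erase_add_one ha).symm
    rw [h2, h3] at h1
    push_cast at h1
    linarith
  · have h2 := card_covered_insert G S B a
    by_cases haS : a ∈ S
    · rw [insert_eq_of_mem haS] at h2
      have h3 : (nbrsIn G a (B \ covered G S B)).card = 0 := by omega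
      simpa [h3] using hc
    · have h1 := hmax (insert a S) (mem_powerset.mpr (insert_subset ha hS))
      simp only [h2, card_insert_of_notMem haS] at h1
      push_cast at h1
      linarith

theorem card_covered_le_of_not_hasWideComb {V : Type*} {G : SimpleGraph V} {A : Finset V}
    {n : ℝ} (m : ℕ) {B : Finset V} {Δ : ℝ} (hAB : Disjoint A B) (hΔ : 0 < Δ)
    (hm : Δ < 4 ^ m) (h : ∀ a ∈ A, ((nbrsIn G a B).card : ℝ) ≤ Δ)
    (hcomb : ¬ HasWideComb G A B n) :
    ((covered G A B).card : ℝ) ≤ 4 * Real.sqrt (n * Δ) := by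
  induction m generalizing B Δ with
  | zero =>
    have h0 : covered G A B = ∅ := by
      refine filter_eq_empty_iff.mpr fun v hv ⟨a, ha, hadj⟩ => ?_
      have h1 : (1 : ℝ) ≤ (nbrsIn G a B).card := by
        exact_mod_cast card_pos.mpr ⟨v, mem_filter.mpr ⟨hv, hadj⟩⟩
      have h2 := h a ha
      rw [pow_zero] at hm
      linarith
    rw [h0]
    simp
  | succ m ih =>
    obtain ⟨S, hSA, hpriv, hrest⟩ := exists_subset_privateNbrs_ge G A B (c := Δ / 4) (by positivity)
    have hsub : B \ covered G S B ⊆ B := sdiff_subset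
    have hih := ih (disjoint_of_subset_right hsub hAB) (Δ := Δ / 4) (by positivity)
      (by rw [pow_succ] at hm; linarith) hrest (fun hc => hcomb (hc.mono hsub))
    have hsqrt : Real.sqrt (n * (Δ / 4)) = Real.sqrt (n * Δ) / 2 := by
      rw [show n * (Δ / 4) = n * Δ / 2 ^ 2 by ring, Real.sqrt_div' _ (by norm_num),
        Real.sqrt_sq (by norm_num)]
    have hS : ((covered G S B).card : ℝ) ≤ 2 * Real.sqrt (n * Δ) := by
      refine (card_covered_le G S B fun a ha => h a (hSA ha)).trans ?_
      rcases S.eq_empty_or_nonempty with rfl | hne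
      · simp
      have hpos : (0 : ℝ) < S.card := by exact_mod_cast hne.card_pos
      have hlt : Δ / 4 < n / (S.card : ℝ) ^ 2 := by
        by_contra! hle
        exact hcomb (hasWideComb_of_privateNbrs hAB hSA hne fun a ha => hle.trans (hpriv a ha))
      rw [lt_div_iff₀ (by positivity)] at hlt
      have hle : S.card * Δ / 2 ≤ Real.sqrt (n * Δ) := by
        apply Real.le_sqrt_of_sq_le
        calc (S.card * Δ / 2) ^ 2 = Δ / 4 * (S.card : ℝ) ^ 2 * Δ := by ring
          _ ≤ n * Δ := by gcongr
      linarith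
    have hunion : covered G A B ⊆ covered G S B ∪ covered G A (B \ covered G S B) := by
      intro v hv
      by_cases hvS : v ∈ covered G S B
      · exact mem_union_left _ hvS
      · obtain ⟨hvB, hvA⟩ := mem_filter.mp hv
        exact mem_union_right _ (mem_filter.mpr ⟨mem_sdiff.mpr ⟨hvB, hvS⟩, hvA⟩)
    have hcard : ((covered G A B).card : ℝ) ≤
        (covered G S B).card + (covered G A (B \ covered G S B)).card := by
      exact_mod_cast (card_le_card hunion).trans (card_union_le _ _)
    rw [hsqrt] at hih
    linarith

/-- the comb lemma. -/
theorem comb_lemma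
    (V : Type) [Fintype V] (G : SimpleGraph V) (A B : Finset V)
    (hA : A.Nonempty) (hB : B.Nonempty) (hAB : Disjoint A B) (Δ : ℝ) (hΔ : 0 < Δ)
    (h : ∀ a ∈ A, ((nbrsIn G a B).card : ℝ) ≤ Δ) :
    ((B.filter (fun v => ∃ a ∈ A, G.Adj a v)).card : ℝ) ≤
        20 * Real.sqrt ((B.card : ℝ) * Δ) ∨
    ∃ k : ℕ, 1 ≤ k ∧ ∃ (a : Fin k → V) (Bl : Fin k → Finset V),
      IsComb G a Bl ∧ (∀ i, a i ∈ A) ∧ (∀ i, Bl i ⊆ B) ∧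
      (∀ i, (B.card : ℝ) / (k : ℝ) ^ 2 ≤ ((Bl i).card : ℝ)) := by
  rw [or_iff_not_imp_right]
  intro hcomb
  obtain ⟨m, hm⟩ := pow_unbounded_of_one_lt Δ (by norm_num : (1 : ℝ) < 4)
  have hle : ((covered G A B).card : ℝ) ≤ 4 * Real.sqrt ((B.card : ℝ) * Δ) :=
    card_covered_le_of_not_hasWideComb m hAB hΔ hm h hcomb
  refine hle.trans ?_
  gcongr
  norm_num
end

section
/- Let η = 2^{-5}. Then every η-sparse P5-free graph G with |G| ≥ η^{-1} contains an anticomplete (2, η·|G|)-blockade; that is, there are disjoint subsets B_1, B_2 of V(G), each of size at least η·|G|, with no edge between B_1 and B_2. -/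
open Finset
open scoped Classical

/-- Every split of `C` into two nonempty parts is crossed by an edge of `G`. -/
def ConnectedOn {V : Type*} (G : SimpleGraph V) (C : Finset V) : Prop :=
  ∀ X ⊆ C, X.Nonempty → AnticompletePair G X (C \ X) → X = C

/-- If `S` cannot be split into two anticomplete parts of size at least `k`, then all but fewer
than `k` of its vertices lie in a single connected part, anticomplete to the rest of `S`. -/
theorem exists_large_connectedOn {V : Type*} (G : SimpleGraph V) (S : Finset V) (k : ℝ)
    (hk : 0 < k) (hS : 3 * k ≤ S.card)
    (hG : ∀ X ⊆ S, k ≤ X.card → k ≤ (S \ X).card → ¬ AnticompletePair G X (S \ X)) :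
    ∃ C ⊆ S, ConnectedOn G C ∧ AnticompletePair G C (S \ C) ∧ (S.card : ℝ) - k < C.card := by
  have hcard : ∀ X ⊆ S, ((S \ X).card : ℝ) = S.card - X.card := fun X hX =>
    Finset.cast_card_sdiff hX
  obtain ⟨C, hC, hmin⟩ := Finset.exists_min_image
    (S.powerset.filter fun C => AnticompletePair G C (S \ C) ∧ (S.card : ℝ) - k < C.card)
    Finset.card ⟨S, by simp +contextual [AnticompletePair, hk]⟩
  simp only [Finset.mem_filter, Finset.mem_powerset] at hC hmin
  obtain ⟨hCS, hCanti, hCcard⟩ := hC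
  refine ⟨C, hCS, ?_, hCanti, hCcard⟩
  have small : ∀ Y ⊂ C, AnticompletePair G Y (C \ Y) → (Y.card : ℝ) < k := by
    intro Y hY hanti
    have hYS := hY.subset.trans hCS
    have hanti' : AnticompletePair G Y (S \ Y) := by
      intro a ha b hb
      by_cases hbC : b ∈ C
      · exact hanti a ha b (Finset.mem_sdiff.2 ⟨hbC, (Finset.mem_sdiff.1 hb).2⟩)
      · exact hCanti a (hY.subset ha) b (Finset.mem_sdiff.2 ⟨(Finset.mem_sdiff.1 hb).1, hbC⟩)
    by_contra! hYk
    refine hG Y hYS hYk ?_ hanti'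
    by_contra! hlt
    have hle := hmin Y ⟨hYS, hanti', by rw [hcard Y hYS] at hlt; linarith⟩
    exact absurd (Finset.card_lt_card hY) (by omega)
  intro X hXC hXne hanti
  by_contra hne
  have h₁ := small X (hXC.ssubset_of_ne hne) hanti
  have h₂ := small (C \ X) (Finset.sdiff_ssubset hXC hXne) (by
    intro a ha b hb hab
    rw [Finset.sdiff_sdiff_eq_self hXC] at hb
    exact hanti b hb a ha hab.symm)
  rw [Finset.cast_card_sdiff hXC] at h₂
  linarith

/-- One step of the Gyárfás path argument: from a vertex `v` in or adjacent to a large connected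
set `C`, move to a neighbour `w` of `v` in `C` attached to a large connected subset of `C` that
avoids the closed neighbourhood of `v`. -/
theorem ConnectedOn.exists_step {V : Type*} [Fintype V] {G : SimpleGraph V} {k : ℝ} (hk : 1 ≤ k)
    (hdeg : ∀ v, ((nbrsIn G v Finset.univ).card : ℝ) ≤ k)
    (hG : ∀ X Y : Finset V, Disjoint X Y → k ≤ X.card → k ≤ Y.card → ¬ AnticompletePair G X Y)
    {C : Finset V} (hC : ConnectedOn G C) (hcard : 5 * k ≤ C.card) {v : V}
    (hv : ∃ x ∈ C, x = v ∨ G.Adj v x) :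
    ∃ w ∈ C, G.Adj v w ∧ ∃ D ⊆ C, ConnectedOn G D ∧ v ∉ D ∧ (∀ x ∈ D, ¬ G.Adj v x) ∧
      (∃ x ∈ D, G.Adj w x) ∧ (C.card : ℝ) - 3 * k < D.card := by
  set S := C \ insert v (nbrsIn G v Finset.univ) with hSdef
  have hmem : ∀ x, x ∈ S ↔ x ∈ C ∧ x ≠ v ∧ ¬ G.Adj v x := by
    intro x
    simp [hSdef, nbrsIn]
  have hScard : (C.card : ℝ) - 2 * k ≤ S.card := by
    have h₁ := Finset.card_le_card_sdiff_add_card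
      (s := C) (t := insert v (nbrsIn G v Finset.univ))
    have h₂ := Finset.card_insert_le v (nbrsIn G v Finset.univ)
    have h₃ : (C.card : ℝ) ≤ S.card + ((nbrsIn G v Finset.univ).card + 1) := by
      exact_mod_cast h₁.trans (Nat.add_le_add_left h₂ _)
    linarith [hdeg v]
  obtain ⟨D, hDS, hD, hDanti, hDcard⟩ := exists_large_connectedOn G S k (by linarith)
    (by linarith) fun X _ => hG X (S \ X) Finset.disjoint_sdiff
  have hDmem := fun x hx => (hmem x).1 (hDS hx)
  have hDC : D ⊆ C := fun x hx => (hDmem x hx).1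
  have hDne : D.Nonempty := by
    rw [← Finset.card_pos, ← Nat.cast_pos (α := ℝ)]
    linarith
  have hDneC : D ≠ C := by
    rintro rfl
    obtain ⟨x, hx, h⟩ := hv
    have := hDmem x hx
    tauto
  have hedge : ¬ AnticompletePair G D (C \ D) := fun h => hDneC (hC D hDC hDne h)
  simp only [AnticompletePair, not_forall, not_not] at hedge
  obtain ⟨x, hx, w, hw, hxw⟩ := hedge
  obtain ⟨hwC, hwD⟩ := Finset.mem_sdiff.1 hw
  have hwv : w ≠ v := by
    rintro rfl
    exact (hDmem x hx).2.2 hxw.symm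
  have hvw : G.Adj v w := by
    by_contra h
    exact hDanti x hx w (Finset.mem_sdiff.2 ⟨(hmem w).2 ⟨hwC, hwv, h⟩, hwD⟩) hxw
  exact ⟨w, hwC, hvw, D, hDC, hD, fun h => (hDmem v h).2.1 rfl, fun y hy => (hDmem y hy).2.2,
    ⟨x, hx, hxw.symm⟩, by linarith⟩

/-- sparse `P5`-free graphs have a linear anticomplete pair. -/
theorem sparse_p5_free_anticomplete_pair
    (V : Type) [Fintype V] (G : SimpleGraph V)
    (hsp : Sparse G (1 / 2 ^ 5)) (hfree : Free P5 G)
    (hcard : ((2 : ℝ) ^ 5) ≤ (Fintype.card V : ℝ)) :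
    ∃ B₁ B₂ : Finset V, Disjoint B₁ B₂ ∧
      (1 / 2 ^ 5 : ℝ) * (Fintype.card V : ℝ) ≤ (B₁.card : ℝ) ∧
      (1 / 2 ^ 5 : ℝ) * (Fintype.card V : ℝ) ≤ (B₂.card : ℝ) ∧
      AnticompletePair G B₁ B₂ := by
  by_contra hno
  set k : ℝ := 1 / 2 ^ 5 * (Fintype.card V : ℝ) with hkdef
  have hk : 1 ≤ k := by rw [hkdef]; linarith
  have hG : ∀ X Y : Finset V, Disjoint X Y → k ≤ X.card → k ≤ Y.card →
      ¬ AnticompletePair G X Y :=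
    fun X Y h h₁ h₂ h₃ => hno ⟨X, Y, h, h₁, h₂, h₃⟩
  have huniv : ((Finset.univ : Finset V).card : ℝ) = 32 * k := by
    rw [Finset.card_univ, hkdef]; ring
  obtain ⟨C₀, -, hC₀, -, hcard₀⟩ := exists_large_connectedOn G Finset.univ k (by linarith)
    (by linarith) fun X _ => hG X _ Finset.disjoint_sdiff
  obtain ⟨v₁, hv₁⟩ : C₀.Nonempty := by
    rw [← Finset.card_pos, ← Nat.cast_pos (α := ℝ)]
    linarith
  obtain ⟨v₂, -, h₁₂, C₁, -, hC₁, hv₁C, hn₁, ⟨x₂, hx₂, hvx₂⟩, hcard₁⟩ :=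
    hC₀.exists_step hk hsp hG (by linarith) ⟨v₁, hv₁, Or.inl rfl⟩
  obtain ⟨v₃, hv₃, h₂₃, C₂, hCC₂, hC₂, hv₂C, hn₂, ⟨x₃, hx₃, hvx₃⟩, hcard₂⟩ :=
    hC₁.exists_step hk hsp hG (by linarith) ⟨x₂, hx₂, Or.inr hvx₂⟩
  obtain ⟨v₄, hv₄, h₃₄, C₃, hCC₃, -, hv₃C, hn₃, ⟨v₅, hv₅, h₄₅⟩, -⟩ :=
    hC₂.exists_step hk hsp hG (by linarith) ⟨x₃, hx₃, Or.inr hvx₃⟩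
  have hv₅₂ := hCC₃ hv₅
  have n₁₃ := hn₁ v₃ hv₃
  have n₁₄ := hn₁ v₄ (hCC₂ hv₄)
  have n₁₅ := hn₁ v₅ (hCC₂ hv₅₂)
  have n₂₄ := hn₂ v₄ hv₄
  have n₂₅ := hn₂ v₅ hv₅₂
  have n₃₅ := hn₃ v₅ hv₅
  have hadj : ∀ u v : Fin 5, P5.Adj u v ↔
      G.Adj (![v₁, v₂, v₃, v₄, v₅] u) (![v₁, v₂, v₃, v₄, v₅] v) := by
    intro u v
    fin_cases u <;> fin_cases v <;>
      simp [P5, SimpleGraph.pathGraph_adj, G.adj_comm v₂ v₁, G.adj_comm v₃ v₁, G.adj_comm v₄ v₁,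
        G.adj_comm v₅ v₁, G.adj_comm v₃ v₂, G.adj_comm v₄ v₂, G.adj_comm v₅ v₂,
        G.adj_comm v₄ v₃, G.adj_comm v₅ v₃, G.adj_comm v₅ v₄, *]
  refine hfree ⟨![v₁, v₂, v₃, v₄, v₅], fun u v huv => ?_, hadj⟩
  have hsame : ∀ w, P5.Adj u w ↔ P5.Adj v w := fun w => by rw [hadj, hadj, huv]
  simp only [P5, SimpleGraph.pathGraph_adj] at hsame
  clear huv
  revert u v
  decide
end
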